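/- arXiv:1601.06264 — 2 statements merged into one kernel-verified Lean document; each statement's English description precedes it below -/
import Mathlib

section
/- Let P ∈ ℝ[X₁,…,Xₙ]. Then P is of type A if and only if P is of type B; that is, every positive definite linear functional on ℝ[X₁,…,Xₙ] vanishing on the ideal (P) is a moment functional if and only if every positive definite linear functional vanishing on the vanishing ideal I(Z_P) is a moment functional. -/
open MeasureTheory

noncomputable def evalR {n : ℕ} (P : MvPolynomial (Fin n) ℝ) (x : Fin n → ℝ) : ℝ :=
  MvPolynomial.eval x P

def IsPosDefR {n : ℕ} (Λ : MvPolynomial (Fin n) ℝ →ₗ[ℝ] ℝ) : Prop :=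
  ∀ P : MvPolynomial (Fin n) ℝ, 0 ≤ Λ (P ^ 2)

def IsMomentR {n : ℕ} (Λ : MvPolynomial (Fin n) ℝ →ₗ[ℝ] ℝ) : Prop :=
  ∃ μ : Measure (Fin n → ℝ),
    (∀ Q : MvPolynomial (Fin n) ℝ, Integrable (fun x => evalR Q x) μ) ∧
    (∀ Q : MvPolynomial (Fin n) ℝ, Λ Q = ∫ x, evalR Q x ∂μ)

noncomputable def vanishingIdealR {n : ℕ} (Z : Set (Fin n → ℝ)) :
    Ideal (MvPolynomial (Fin n) ℝ) where
  carrier := {P | ∀ x ∈ Z, evalR P x = 0}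
  add_mem' := by
    intro a b ha hb x hx
    simp only [Set.mem_setOf_eq, evalR, map_add] at *
    rw [ha x hx, hb x hx, add_zero]
  zero_mem' := by
    intro x hx
    simp [evalR]
  smul_mem' := by
    intro c a ha x hx
    simp only [Set.mem_setOf_eq, evalR, smul_eq_mul, map_mul] at *
    rw [ha x hx, mul_zero]

def zeroSetR {n : ℕ} (I : Ideal (MvPolynomial (Fin n) ℝ)) : Set (Fin n → ℝ) :=
  {x | ∀ P ∈ I, evalR P x = 0}

def zSetR {n : ℕ} (P : MvPolynomial (Fin n) ℝ) : Set (Fin n → ℝ) :=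
  {x | evalR P x = 0}

def VanishesOnR {n : ℕ} (Λ : MvPolynomial (Fin n) ℝ →ₗ[ℝ] ℝ)
    (I : Ideal (MvPolynomial (Fin n) ℝ)) : Prop :=
  ∀ P ∈ I, Λ P = 0

def nSetR {n : ℕ} (Λ : MvPolynomial (Fin n) ℝ →ₗ[ℝ] ℝ) : Set (MvPolynomial (Fin n) ℝ) :=
  {P | Λ (P ^ 2) = 0}

def IsTypeAR {n : ℕ} (P : MvPolynomial (Fin n) ℝ) : Prop :=
  ∀ Λ : MvPolynomial (Fin n) ℝ →ₗ[ℝ] ℝ,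
    IsPosDefR Λ → VanishesOnR Λ (Ideal.span {P}) → IsMomentR Λ

namespace RealNullstellensatz

open Polynomial

section IntermediateValue

variable {R : Type*} [Field R] [LinearOrder R] [IsStrictOrderedRing R]

/-- The intermediate value property for polynomials over an ordered field. -/
def PolyIVT (R : Type*) [Field R] [LinearOrder R] : Prop :=
  ∀ (f : R[X]) (a b : R), a < b → f.eval a * f.eval b < 0 → ∃ c, a < c ∧ c < b ∧ f.eval c = 0

theorem PolyIVT.eval_mul_eval_pos (hR : PolyIVT R) {f : R[X]} {a b : R} (hab : a ≤ b)
    (h : ∀ c, a ≤ c → c ≤ b → f.eval c ≠ 0) : 0 < f.eval a * f.eval b := by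
  rcases hab.eq_or_lt with rfl | hab'
  · exact mul_self_pos.2 (h a le_rfl le_rfl)
  · by_contra hneg
    rcases (not_lt.1 hneg).lt_or_eq with hlt | heq
    · obtain ⟨c, hac, hcb, hc⟩ := hR f a b hab' hlt
      exact h c hac.le hcb.le hc
    · rcases mul_eq_zero.1 heq with h0 | h0
      · exact h a le_rfl hab h0
      · exact h b hab le_rfl h0

theorem PolyIVT.sign_eval_eq (hR : PolyIVT R) {f : R[X]} (h : ∀ c, f.eval c ≠ 0) (a b : R) :
    SignType.sign (f.eval a) = SignType.sign (f.eval b) := by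
  have key : 0 < f.eval a * f.eval b := by
    rcases le_total a b with hab | hab
    · exact hR.eval_mul_eval_pos hab fun c _ _ => h c
    · rw [mul_comm]
      exact hR.eval_mul_eval_pos hab fun c _ _ => h c
  rcases pos_and_pos_or_neg_and_neg_of_mul_pos key with ⟨h1, h2⟩ | ⟨h1, h2⟩
  · rw [sign_pos h1, sign_pos h2]
  · rw [sign_neg h1, sign_neg h2]

theorem exists_eq_pow_mul {R : Type*} [Field R] {f : R[X]} (hf : f ≠ 0) {a : R}
    (ha : f.eval a = 0) :
    ∃ (m : ℕ) (g : R[X]), f = (X - C a) ^ (m + 1) * g ∧ g.eval a ≠ 0 := by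
  obtain ⟨g, hg, hdvd⟩ := f.exists_eq_pow_rootMultiplicity_mul_and_not_dvd hf a
  have hpos : 0 < f.rootMultiplicity a := (rootMultiplicity_pos hf).2 ha
  refine ⟨f.rootMultiplicity a - 1, g, ?_, fun h => hdvd (dvd_iff_isRoot.2 h)⟩
  rwa [Nat.sub_add_cancel hpos]

theorem PolyIVT.rolle_of_consecutive (hR : PolyIVT R) {f : R[X]} (hf : f ≠ 0) {a b : R}
    (hab : a < b) (ha : f.eval a = 0) (hb : f.eval b = 0)
    (hroot : ∀ c, a < c → c < b → f.eval c ≠ 0) :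
    ∃ c, a < c ∧ c < b ∧ f.derivative.eval c = 0 := by
  obtain ⟨m, g, rfl, hga⟩ := exists_eq_pow_mul hf ha
  have hg0 : g ≠ 0 := by rintro rfl; simp at hga
  have hgb : g.eval b = 0 := by
    have : b - a ≠ 0 := sub_ne_zero.2 hab.ne'
    simpa [this] using hb
  obtain ⟨k, g, rfl, hgb'⟩ := exists_eq_pow_mul hg0 hgb
  have hga' : g.eval a ≠ 0 := by
    intro h; simp [h] at hga
  have hpos : 0 < g.eval a * g.eval b := by
    refine hR.eval_mul_eval_pos hab.le fun c h1 h2 hc => ?_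
    rcases h1.eq_or_lt with rfl | h1
    · exact hga' hc
    rcases h2.eq_or_lt with rfl | h2
    · exact hgb' hc
    exact hroot c h1 h2 (by simp [hc])
  set G : R[X] := C (m + 1 : R) * (X - C b) * g + C (k + 1 : R) * (X - C a) * g
    + (X - C a) * (X - C b) * derivative g with hG
  have hsign : G.eval a * G.eval b < 0 := by
    have e : G.eval a * G.eval b
        = -((m + 1 : R) * (k + 1 : R) * (b - a) ^ 2 * (g.eval a * g.eval b)) := by
      simp [hG]; ring
    rw [e, neg_lt_zero]
    have : 0 < b - a := sub_pos.2 hab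
    positivity
  obtain ⟨c, h1, h2, hc⟩ := hR G a b hab hsign
  refine ⟨c, h1, h2, ?_⟩
  have e : derivative ((X - C a) ^ (m + 1) * ((X - C b) ^ (k + 1) * g))
      = (X - C a) ^ m * (X - C b) ^ k * G := by
    simp only [derivative_mul, derivative_X_sub_C_pow, hG, Nat.add_sub_cancel]
    simp only [Nat.cast_add, Nat.cast_one, map_add, map_natCast, map_one]
    ring
  rw [e, eval_mul, hc, mul_zero]

theorem PolyIVT.rolle (hR : PolyIVT R) {f : R[X]} {a b : R}
    (hab : a < b) (ha : f.eval a = 0) (hb : f.eval b = 0) :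
    ∃ c, a < c ∧ c < b ∧ f.derivative.eval c = 0 := by
  classical
  rcases eq_or_ne f 0 with rfl | hf
  · obtain ⟨c, h1, h2⟩ := exists_between hab
    exact ⟨c, h1, h2, by simp⟩
  set s := f.roots.toFinset.filter fun c => a < c with hs
  have hmem : ∀ c, c ∈ s ↔ f.eval c = 0 ∧ a < c := by simp [hs, hf]
  obtain ⟨d, hd, hmin⟩ := s.exists_min_image id ⟨b, (hmem b).2 ⟨hb, hab⟩⟩
  obtain ⟨hd0, had⟩ := (hmem d).1 hd
  obtain ⟨c, h1, h2, hc⟩ := hR.rolle_of_consecutive hf had ha hd0 fun c h1 h2 h0 =>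
    absurd (hmin c ((hmem c).2 ⟨h0, h1⟩)) (not_le.2 h2)
  exact ⟨c, h1, h2.trans_le (hmin b ((hmem b).2 ⟨hb, hab⟩)), hc⟩

/-- A simple root without a root of the derivative in `[u, v]` is a sign change. -/
theorem PolyIVT.eval_mul_eval_neg (hR : PolyIVT R) {f : R[X]} {u y v : R} (huy : u < y)
    (hyv : y < v) (hy : f.eval y = 0)
    (hder : ∀ c, u < c → c < v → f.derivative.eval c ≠ 0) : f.eval u * f.eval v < 0 := by
  obtain ⟨k, rfl⟩ := dvd_iff_isRoot.2 hy
  have hk : 0 < k.eval u * k.eval v := by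
    refine hR.eval_mul_eval_pos (huy.trans hyv).le fun c h1 h2 hc => ?_
    rcases lt_trichotomy c y with h | rfl | h
    · obtain ⟨d, hd1, hd2, hd⟩ := hR.rolle h (by simp [hc]) hy
      exact hder d (h1.trans_lt hd1) (hd2.trans hyv) hd
    · exact hder c huy hyv (by simp [derivative_mul, hc])
    · obtain ⟨d, hd1, hd2, hd⟩ := hR.rolle h hy (by simp [hc])
      exact hder d (huy.trans hd1) (hd2.trans_le h2) hd
  have e : ((X - C y) * k).eval u * ((X - C y) * k).eval v
      = -((y - u) * (v - y) * (k.eval u * k.eval v)) := by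
    simp; ring
  rw [e, neg_lt_zero]
  exact mul_pos (mul_pos (sub_pos.2 huy) (sub_pos.2 hyv)) hk

/-- Roots of a monic polynomial are bounded by an expression in the coefficients. -/
theorem abs_root_lt {f : R[X]} (hf : f.Monic) {y : R} (hy : f.eval y = 0) :
    |y| < 1 + ∑ i ∈ Finset.range f.natDegree, (1 + f.coeff i ^ 2) := by
  set d := f.natDegree with hd
  have hS : ∀ i ∈ Finset.range d, (0 : R) ≤ 1 + f.coeff i ^ 2 := fun i _ => by positivity
  rcases lt_or_ge |y| 1 with h1 | h1
  · have := Finset.sum_nonneg hS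
    linarith
  have hd0 : d ≠ 0 := by
    intro h0
    rw [hf.natDegree_eq_zero.1 (hd.symm.trans h0)] at hy
    simp at hy
  obtain ⟨e, he⟩ := Nat.exists_eq_succ_of_ne_zero hd0
  have hypos : 0 < |y| := by linarith
  have h2 : y ^ d = -∑ i ∈ Finset.range d, f.coeff i * y ^ i := by
    rw [eval_eq_sum_range, Finset.sum_range_succ, ← hd, hf.coeff_natDegree, one_mul] at hy
    linarith
  have h3 : |y| ^ d ≤ (∑ i ∈ Finset.range d, (1 + f.coeff i ^ 2)) * |y| ^ e := by
    rw [← abs_pow, h2, abs_neg, Finset.sum_mul]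
    refine (Finset.abs_sum_le_sum_abs _ _).trans (Finset.sum_le_sum fun i hi => ?_)
    rw [abs_mul, abs_pow]
    have hie : i ≤ e := by have := Finset.mem_range.1 hi; omega
    refine mul_le_mul ?_ (pow_le_pow_right₀ h1 hie) (by positivity) (hS i hi)
    nlinarith [sq_abs (f.coeff i), sq_nonneg (|f.coeff i| - 1), abs_nonneg (f.coeff i)]
  rw [he, pow_succ', mul_le_mul_iff_left₀ (by positivity)] at h3
  rw [he]
  linarith

end IntermediateValue

section RootsLift

variable {B R S : Type*} [CommRing B] [Field R] [Field S]

/-- All nonzero polynomials over `B` of degree at most `d` have their roots in the images of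
`B`. -/
def RootsLift (p : B →+* R) (q : B →+* S) (d : ℕ) : Prop :=
  ∀ h : B[X], h ≠ 0 → h.natDegree ≤ d →
    (∀ y, h.eval₂ p y = 0 → ∃ b, p b = y) ∧ ∀ z, h.eval₂ q z = 0 → ∃ b, q b = z

variable {p : B →+* R} {q : B →+* S}

theorem RootsLift.mono {d e : ℕ} (h : RootsLift p q e) (hde : d ≤ e) : RootsLift p q d :=
  fun g hg hd => h g hg (hd.trans hde)

theorem RootsLift.symm {d : ℕ} (h : RootsLift p q d) : RootsLift q p d :=
  fun g hg hd => ⟨(h g hg hd).2, (h g hg hd).1⟩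

end RootsLift

section SignPair

variable {B R S : Type*} [CommRing B] [Field R] [LinearOrder R] [Field S] [LinearOrder S]

/-- Two homomorphisms into ordered fields that induce the same signs, and that admit no further
pair of elements with compatible signs. -/
structure IsMaximalSignPair (p : B →+* R) (q : B →+* S) : Prop where
  sign_eq : ∀ b, SignType.sign (p b) = SignType.sign (q b)
  injective : Function.Injective p
  exists_of_sign_eq : ∀ y z,
    (∀ g : B[X], SignType.sign (g.eval₂ p y) = SignType.sign (g.eval₂ q z)) →
      ∃ b, p b = y ∧ q b = z

variable {p : B →+* R} {q : B →+* S}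

theorem eq_zero_iff_of_sign_eq (h : ∀ b, SignType.sign (p b) = SignType.sign (q b)) (b : B) :
    p b = 0 ↔ q b = 0 := by
  rw [← sign_eq_zero_iff, h, sign_eq_zero_iff]

theorem IsMaximalSignPair.symm (h : IsMaximalSignPair p q) : IsMaximalSignPair q p where
  sign_eq b := (h.sign_eq b).symm
  injective := by
    rw [injective_iff_map_eq_zero]
    exact fun b hb => (injective_iff_map_eq_zero p).1 h.injective b
      ((eq_zero_iff_of_sign_eq h.sign_eq b).2 hb)
  exists_of_sign_eq z y hyz := by
    obtain ⟨b, h1, h2⟩ := h.exists_of_sign_eq y z fun g => (hyz g).symm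
    exact ⟨b, h2, h1⟩

variable [IsStrictOrderedRing R] [IsStrictOrderedRing S]

theorem lt_iff_lt_of_sign_eq (h : ∀ b, SignType.sign (p b) = SignType.sign (q b)) (a b : B) :
    p a < p b ↔ q a < q b := by
  rw [← sub_pos, ← sub_pos (a := q b), ← map_sub, ← map_sub, ← sign_eq_one_iff, h,
    sign_eq_one_iff]

theorem IsMaximalSignPair.lt_iff_lt (h : IsMaximalSignPair p q) (a b : B) :
    p a < p b ↔ q a < q b :=
  lt_iff_lt_of_sign_eq h.sign_eq a b

theorem IsMaximalSignPair.exists_mul_eq_one (h : IsMaximalSignPair p q) {b : B} (hb : b ≠ 0) :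
    ∃ c, c * b = 1 := by
  have hp : p b ≠ 0 := (map_ne_zero_iff p h.injective).2 hb
  have hq : q b ≠ 0 := (map_ne_zero_iff q h.symm.injective).2 hb
  obtain ⟨c, hc, -⟩ := h.exists_of_sign_eq (p b)⁻¹ (q b)⁻¹ fun g => by
    let _ : Invertible (p b)⁻¹ := ⟨p b, mul_inv_cancel₀ hp, inv_mul_cancel₀ hp⟩
    let _ : Invertible (q b)⁻¹ := ⟨q b, mul_inv_cancel₀ hq, inv_mul_cancel₀ hq⟩
    rw [← eval₂_reverse_mul_pow p (p b)⁻¹ g, ← eval₂_reverse_mul_pow q (q b)⁻¹ g]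
    have e1 : ⅟((p b)⁻¹) = p b := rfl
    have e2 : ⅟((q b)⁻¹) = q b := rfl
    rw [e1, e2, eval₂_at_apply, eval₂_at_apply, sign_mul, sign_mul, h.sign_eq, sign_pow, sign_pow]
    congr 2
    have := h.sign_eq b
    rcases lt_or_gt_of_ne hp with h1 | h1
    · rw [sign_neg h1, eq_comm, sign_eq_neg_one_iff] at this
      rw [sign_neg (inv_lt_zero.2 h1), sign_neg (inv_lt_zero.2 this)]
    · rw [sign_pos h1, eq_comm, sign_eq_one_iff] at this
      rw [sign_pos (inv_pos.2 h1), sign_pos (inv_pos.2 this)]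
  exact ⟨c, h.injective (by rw [map_mul, hc, map_one, inv_mul_cancel₀ hp])⟩

/-- The sign of a polynomial at a point is determined by the cut of that point. -/
theorem IsMaximalSignPair.eventually_sign_eval₂_eq (h : IsMaximalSignPair p q)
    (hR : PolyIVT R) (hS : PolyIVT S) {ι : Type*} {l : Filter ι} {y : R} {z : ι → S}
    (hcut : ∀ b, ∀ᶠ i in l, SignType.sign (y - p b) = SignType.sign (z i - q b)) (g : B[X])
    (hroots : RootsLift p q g.natDegree) :
    ∀ᶠ i in l, SignType.sign (g.eval₂ p y) = SignType.sign (g.eval₂ q (z i)) := by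
  induction hd : g.natDegree generalizing g with
  | zero =>
    rw [eq_C_of_natDegree_eq_zero hd]
    simp [h.sign_eq]
  | succ d ih =>
    have hg0 : g ≠ 0 := by rintro rfl; simp at hd
    by_cases hb : ∃ b, g.IsRoot b
    · obtain ⟨b, hb⟩ := hb
      have hfac := mul_divByMonic_eq_iff_isRoot.2 hb
      have hdeg : (g /ₘ (X - C b)).natDegree = d := by
        have : Nontrivial B := p.domain_nontrivial
        rw [natDegree_divByMonic g (monic_X_sub_C b), hd, natDegree_X_sub_C, Nat.add_sub_cancel]
      filter_upwards [ih _ (hroots.mono (by omega)) hdeg, hcut b] with i h1 h2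
      rw [← hfac]
      simp only [eval₂_mul, eval₂_sub, eval₂_X, eval₂_C, sign_mul, h1, h2]
    · have hp : ∀ c, (g.map p).eval c ≠ 0 := by
        intro c hc
        rw [eval_map] at hc
        obtain ⟨b, rfl⟩ := (hroots g hg0 le_rfl).1 c hc
        rw [eval₂_at_apply, map_eq_zero_iff p h.injective] at hc
        exact hb ⟨b, hc⟩
      have hq : ∀ c, (g.map q).eval c ≠ 0 := by
        intro c hc
        rw [eval_map] at hc
        obtain ⟨b, rfl⟩ := (hroots g hg0 le_rfl).2 c hc
        rw [eval₂_at_apply, map_eq_zero_iff q h.symm.injective] at hc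
        exact hb ⟨b, hc⟩
      refine Filter.Eventually.of_forall fun i => ?_
      have h1 := hR.sign_eval_eq hp y 0
      have h2 := hS.sign_eval_eq hq (z i) 0
      rw [eval_map, eval_map] at h1 h2
      rw [h1, h2, eval₂_at_zero, eval₂_at_zero, h.sign_eq]

theorem IsMaximalSignPair.exists_root_in_cut (h : IsMaximalSignPair p q)
    (hR : PolyIVT R) (hS : PolyIVT S) {f : B[X]} (hf : f.Monic) {d : ℕ}
    (hfd : f.natDegree = d + 1) (hroots : RootsLift p q d) {y : R} (hy : f.eval₂ p y = 0)
    (hyp : ∀ b, p b ≠ y) :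
    ∃ z, f.eval₂ q z = 0 ∧ ∀ b, SignType.sign (y - p b) = SignType.sign (z - q b) := by
  classical
  by_contra! hcon
  choose! β hβ using hcon
  have hf0 : f.map q ≠ 0 := (hf.map q).ne_zero
  have hder0 : derivative f ≠ 0 := by
    intro h0
    have h1 : (derivative f).coeff d = 0 := by rw [h0, coeff_zero]
    rw [coeff_derivative, ← hfd, hf.coeff_natDegree, one_mul] at h1
    have h2 := congrArg p h1
    simp only [map_add, map_natCast, map_one, map_zero] at h2
    exact absurd h2 (by positivity)
  have hderd : (derivative f).natDegree ≤ d := by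
    have := natDegree_derivative_le f
    omega
  have hlift := (hroots _ hder0 hderd).1
  choose! γ hγ using hlift
  obtain ⟨M, hM⟩ : ∃ M, |y| < p M :=
    ⟨1 + ∑ i ∈ Finset.range f.natDegree, (1 + f.coeff i ^ 2), by
      have := abs_root_lt (hf.map p) (y := y) (by rwa [eval_map])
      rw [hf.natDegree_map] at this
      simpa using this⟩
  have hM' := abs_lt.1 hM
  set D : Finset B := {M, -M} ∪ ((f.map q).roots.toFinset.image β
    ∪ ((derivative f).map p).roots.toFinset.image γ) with hD
  have hβD : ∀ z, f.eval₂ q z = 0 → β z ∈ D := fun z hz => by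
    simp only [hD, Finset.mem_union, Finset.mem_image]
    refine Or.inr (Or.inl ⟨z, ?_, rfl⟩)
    rw [Multiset.mem_toFinset, mem_roots hf0, IsRoot, eval_map, hz]
  have hγD : ∀ c, (derivative f).eval₂ p c = 0 → γ c ∈ D := fun c hc => by
    simp only [hD, Finset.mem_union, Finset.mem_image]
    refine Or.inr (Or.inr ⟨c, ?_, rfl⟩)
    rw [Multiset.mem_toFinset, mem_roots ((Polynomial.map_ne_zero_iff h.injective).2 hder0),
      IsRoot, eval_map, hc]
  obtain ⟨u, hu, humax⟩ := (D.filter fun b => p b < y).exists_max_image p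
    ⟨-M, by simp only [hD, Finset.mem_filter, map_neg, hM'.1, and_true]; simp⟩
  obtain ⟨v, hv, hvmin⟩ := (D.filter fun b => y < p b).exists_min_image p
    ⟨M, by simp only [hD, Finset.mem_filter, hM'.2, and_true]; simp⟩
  simp only [Finset.mem_filter] at hu hv humax hvmin
  have hneg : f.eval₂ p (p u) * f.eval₂ p (p v) < 0 := by
    rw [← eval_map, ← eval_map]
    refine hR.eval_mul_eval_neg hu.2 hv.2 (by rwa [eval_map]) fun c h1 h2 hc => ?_
    rw [derivative_map, eval_map] at hc
    have hcγ := hγ c hc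
    rcases lt_trichotomy c y with hcy | rfl | hcy
    · exact absurd (humax (γ c) ⟨hγD c hc, by rwa [hcγ]⟩) (by rw [hcγ]; exact not_le.2 h1)
    · exact hyp _ hcγ
    · exact absurd (hvmin (γ c) ⟨hγD c hc, by rwa [hcγ]⟩) (by rw [hcγ]; exact not_le.2 h2)
  rw [eval₂_at_apply, eval₂_at_apply, ← map_mul, ← sign_eq_neg_one_iff, h.sign_eq,
    sign_eq_neg_one_iff, map_mul, ← eval₂_at_apply, ← eval₂_at_apply, ← eval_map,
    ← eval_map] at hneg
  obtain ⟨z, huz, hzv, hz⟩ := hS _ _ _ ((h.lt_iff_lt u v).1 (hu.2.trans hv.2)) hneg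
  rw [eval_map] at hz
  rcases lt_or_gt_of_ne (hyp (β z)) with hlt | hgt
  · have h1 := humax (β z) ⟨hβD z hz, hlt⟩
    rw [← not_lt, h.lt_iff_lt, not_lt] at h1
    exact hβ z hz (by rw [sign_pos (sub_pos.2 hlt), sign_pos (sub_pos.2 (h1.trans_lt huz))])
  · have h1 := hvmin (β z) ⟨hβD z hz, hgt⟩
    rw [← not_lt, h.lt_iff_lt, not_lt] at h1
    exact hβ z hz (by rw [sign_neg (sub_neg.2 hgt), sign_neg (sub_neg.2 (hzv.trans_le h1))])

theorem IsMaximalSignPair.exists_of_root (h : IsMaximalSignPair p q)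
    (hR : PolyIVT R) (hS : PolyIVT S) {f : B[X]} (hf0 : f ≠ 0) {d : ℕ}
    (hfd : f.natDegree = d + 1) (hroots : RootsLift p q d) {y : R} (hy : f.eval₂ p y = 0) :
    ∃ b, p b = y := by
  by_contra! hyp
  obtain ⟨c, hc⟩ := h.exists_mul_eq_one (leadingCoeff_ne_zero.2 hf0)
  have : Nontrivial B := p.domain_nontrivial
  have hmonic : (C c * f).Monic := monic_C_mul_of_mul_leadingCoeff_eq_one hc
  have hdeg : (C c * f).natDegree = d + 1 := by
    rw [natDegree_C_mul_of_mul_ne_zero (by rw [hc]; exact one_ne_zero), hfd]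
  have hroot : (C c * f).eval₂ p y = 0 := by rw [eval₂_mul, hy, mul_zero]
  generalize C c * f = F at hmonic hdeg hroot
  obtain ⟨z, hz, hcut⟩ := h.exists_root_in_cut hR hS hmonic hdeg hroots hroot hyp
  obtain ⟨b, hb, -⟩ := h.exists_of_sign_eq y z fun g => by
    have hlt : (g %ₘ F).natDegree < d + 1 :=
      hdeg ▸ natDegree_modByMonic_lt g hmonic (by
        intro h1; rw [h1, natDegree_one] at hdeg; omega)
    have key := h.eventually_sign_eval₂_eq hR hS (l := (pure () : Filter Unit)) (z := fun _ => z)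
      (fun b => Filter.eventually_pure.2 (hcut b)) (g %ₘ F) (hroots.mono (by omega))
    rw [Filter.eventually_pure] at key
    rw [← modByMonic_add_div g F, eval₂_add, eval₂_add, eval₂_mul,
      eval₂_mul, hz, hroot, zero_mul, zero_mul, add_zero, add_zero, key]
  exact hyp b hb

theorem IsMaximalSignPair.rootsLift (h : IsMaximalSignPair p q)
    (hR : PolyIVT R) (hS : PolyIVT S) (d : ℕ) : RootsLift p q d := by
  induction d with
  | zero =>
    intro f hf hd
    rw [eq_C_of_natDegree_le_zero hd] at hf ⊢
    rw [Ne, C_eq_zero] at hf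
    simp [map_eq_zero_iff p h.injective, map_eq_zero_iff q h.symm.injective, hf]
  | succ d ih =>
    intro f hf hd
    rcases hd.lt_or_eq with hlt | heq
    · exact ih f hf (by omega)
    · exact ⟨fun y hy => h.exists_of_root hR hS hf heq ih hy,
        fun z hz => h.symm.exists_of_root hS hR hf heq ih.symm hz⟩

end SignPair

section Zorn

variable {R S : Type*} [Field R] [LinearOrder R] [Field S] [LinearOrder S]

theorem exists_maximal_signPair {B₀ : Subring (R × S)}
    (h₀ : ∀ x ∈ B₀, SignType.sign x.1 = SignType.sign x.2) :
    ∃ B : Subring (R × S), B₀ ≤ B ∧ IsMaximalSignPair ((RingHom.fst R S).comp B.subtype)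
      ((RingHom.snd R S).comp B.subtype) := by
  obtain ⟨B, hB, hmax⟩ := zorn_le_nonempty₀
    {B : Subring (R × S) | ∀ x ∈ B, SignType.sign x.1 = SignType.sign x.2}
    (fun c hc hchain B hB => ⟨sSup c, fun x hx => by
      obtain ⟨B', hB', hxB'⟩ := (Subring.mem_sSup_of_directedOn ⟨B, hB⟩ hchain.directedOn).1 hx
      exact hc hB' x hxB', fun B' hB' => le_sSup hB'⟩) B₀ h₀
  refine ⟨B, hB, fun b => hmax.prop b b.2, ?_, fun y z hyz => ?_⟩
  · rw [injective_iff_map_eq_zero]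
    intro b hb
    have h2 := hmax.prop b b.2
    change (b : R × S).1 = 0 at hb
    rw [hb, sign_zero, eq_comm, sign_eq_zero_iff] at h2
    exact Subtype.ext (Prod.ext hb h2)
  · have hle : B ≤ (eval₂RingHom B.subtype (y, z)).range := fun b hb => ⟨C ⟨b, hb⟩, by simp⟩
    have hge := hmax.le_of_ge (y := (eval₂RingHom B.subtype (y, z)).range) (by
      rintro _ ⟨g, rfl⟩
      have := hyz g
      rw [coe_eval₂RingHom]
      have e1 := hom_eval₂ g B.subtype (RingHom.fst R S) (y, z)
      have e2 := hom_eval₂ g B.subtype (RingHom.snd R S) (y, z)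
      change (eval₂ B.subtype (y, z) g).1 = _ at e1
      change (eval₂ B.subtype (y, z) g).2 = _ at e2
      rw [e1, e2]
      exact this) hle
    exact ⟨⟨(y, z), hge ⟨X, by simp⟩⟩, rfl, rfl⟩

end Zorn

section Germ

open Filter

variable {ι S : Type*} [Field S] (U : Ultrafilter ι)

/-- The diagonal embedding into an ultrapower. -/
def germConst : S →+* Germ (U : Filter ι) S :=
  (Germ.coeRingHom (U : Filter ι)).comp (Pi.constRingHom ι S)

theorem eval₂_germ {σ A : Type*} [CommRing A] (f : A →+* S) (P : MvPolynomial σ A)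
    (x : σ → ι → S) :
    P.eval₂ ((germConst U).comp f) (fun j => (x j : Germ (U : Filter ι) S))
      = ((fun i => P.eval₂ f fun j => x j i : ι → S) : Germ (U : Filter ι) S) := by
  have e : (fun i => P.eval₂ f fun j => x j i) = P.eval₂ ((Pi.constRingHom ι S).comp f) x := by
    funext i
    exact (MvPolynomial.eval₂_comp_left (Pi.evalRingHom (fun _ => S) i)
      ((Pi.constRingHom ι S).comp f) x P).symm
  rw [e]
  exact (MvPolynomial.eval₂_comp_left (Germ.coeRingHom (U : Filter ι))
    ((Pi.constRingHom ι S).comp f) x P).symm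

theorem vanishing_germ {σ A : Type*} [CommRing A] (f : A →+* S)
    {P Q : MvPolynomial σ A} (h : ∀ x, P.eval₂ f x = 0 → Q.eval₂ f x = 0)
    (x : σ → Germ (U : Filter ι) S) (hx : P.eval₂ ((germConst U).comp f) x = 0) :
    Q.eval₂ ((germConst U).comp f) x = 0 := by
  have hrep : ∀ j, ∃ φ : ι → S, (φ : Germ (U : Filter ι) S) = x j :=
    fun j => Quotient.mk_surjective (x j)
  choose φ hφ using hrep
  obtain rfl : (fun j => (φ j : Germ (U : Filter ι) S)) = x := funext hφ
  rw [eval₂_germ] at hx ⊢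
  refine Germ.coe_eq.2 ?_
  filter_upwards [Germ.coe_eq.1 hx] with i hi
  exact h _ hi

variable [LinearOrder S]

theorem sign_germ {φ : ι → S} {t : SignType} (h : ∀ᶠ i in U, SignType.sign (φ i) = t) :
    SignType.sign (φ : Germ (U : Filter ι) S) = t := by
  cases t with
  | zero =>
    have : (φ : Germ (U : Filter ι) S) = 0 := Germ.coe_eq.2 (by
      filter_upwards [h] with i hi
      exact sign_eq_zero_iff.1 hi)
    rw [this, sign_zero]; rfl
  | pos =>
    refine sign_pos (Germ.coe_pos.2 ?_)
    filter_upwards [h] with i hi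
    exact sign_eq_one_iff.1 hi
  | neg =>
    refine sign_neg ((Germ.coe_lt (g := fun _ => 0)).2 ?_)
    filter_upwards [h] with i hi
    exact sign_eq_neg_one_iff.1 hi

theorem PolyIVT.germ (hS : PolyIVT S) : PolyIVT (Germ (U : Filter ι) S) := by
  intro f a b hab hneg
  obtain ⟨F, rfl⟩ := map_surjective (Germ.coeRingHom (U : Filter ι) (R := S))
    Quotient.mk_surjective f
  induction a using Germ.inductionOn with | _ a
  induction b using Germ.inductionOn with | _ b
  have key : ∀ x : ι → S, (F.map (Germ.coeRingHom (U : Filter ι))).eval (x : Germ (U : Filter ι) S)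
      = ((fun i => (F.map (Pi.evalRingHom (fun _ => S) i)).eval (x i) : ι → S) :
        Germ (U : Filter ι) S) := by
    intro x
    have e : (fun i => (F.map (Pi.evalRingHom (fun _ => S) i)).eval (x i)) = F.eval x := by
      funext i
      exact eval_map_apply (Pi.evalRingHom (fun _ => S) i) x
    rw [e]
    exact eval_map_apply (Germ.coeRingHom (U : Filter ι)) x
  rw [key, key] at hneg
  have h1 := Germ.coe_lt.1 hab
  have h2 := (Germ.coe_lt (g := fun _ => 0)).1 hneg
  have h3 : ∀ᶠ i in U, ∃ c, a i < c ∧ c < b i ∧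
      (F.map (Pi.evalRingHom (fun _ => S) i)).eval c = 0 := by
    filter_upwards [h1, h2] with i hi1 hi2
    exact hS _ _ _ hi1 hi2
  obtain ⟨c, hc⟩ := h3.choice
  refine ⟨(c : Germ (U : Filter ι) S), Germ.coe_lt.2 (hc.mono fun i hi => hi.1),
    Germ.coe_lt.2 (hc.mono fun i hi => hi.2.1), ?_⟩
  rw [key]
  exact Germ.coe_eq.2 (hc.mono fun i hi => hi.2.2)

/-- A cut in the common subring is realised in an ultrapower. -/
theorem IsMaximalSignPair.exists_germ {B R : Type*} [CommRing B] [Field R] [LinearOrder R]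
    [IsStrictOrderedRing R] [IsStrictOrderedRing S] {p : B →+* R} {q : B →+* S}
    (h : IsMaximalSignPair p q) (hR : PolyIVT R) (hS : PolyIVT S) {y : R} (hy : ∀ b, p b ≠ y) :
    ∃ (U : Ultrafilter S) (z : Germ (U : Filter S) S), ∀ g : B[X],
      SignType.sign (g.eval₂ p y) = SignType.sign (g.eval₂ ((germConst U).comp q) z) := by
  classical
  let A : B → Set S := fun b => {s | SignType.sign (y - p b) = SignType.sign (s - q b)}
  have hne : (⨅ b, 𝓟 (A b)).NeBot := by
    refine (hasBasis_iInf_principal_finite A).neBot_iff.2 fun {t} ht => ?_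
    obtain ⟨s, hs1, hs2⟩ := Order.exists_between_finsets
      ((ht.toFinset.filter fun b => p b < y).image q)
      ((ht.toFinset.filter fun b => y < p b).image q) (by
        simp only [Finset.mem_image, Finset.mem_filter]
        rintro _ ⟨a, ha, rfl⟩ _ ⟨b, hb, rfl⟩
        exact (h.lt_iff_lt a b).1 (ha.2.trans hb.2))
    refine ⟨s, Set.mem_iInter₂.2 fun b hb => ?_⟩
    change SignType.sign (y - p b) = SignType.sign (s - q b)
    rcases lt_or_gt_of_ne (hy b) with hlt | hgt
    · rw [sign_pos (sub_pos.2 hlt), sign_pos (sub_pos.2 (hs1 _ (Finset.mem_image_of_mem q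
        (Finset.mem_filter.2 ⟨ht.mem_toFinset.2 hb, hlt⟩))))]
    · rw [sign_neg (sub_neg.2 hgt), sign_neg (sub_neg.2 (hs2 _ (Finset.mem_image_of_mem q
        (Finset.mem_filter.2 ⟨ht.mem_toFinset.2 hb, hgt⟩))))]
  let U := Ultrafilter.of (⨅ b, 𝓟 (A b))
  have hU : ∀ b, ∀ᶠ s in (U : Filter S), SignType.sign (y - p b) = SignType.sign (s - q b) :=
    fun b => (Ultrafilter.of_le _).trans (iInf_le _ b) (mem_principal_self (A b))
  refine ⟨U, ((fun s => s : S → S) : Germ (U : Filter S) S), fun g => ?_⟩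
  have key := h.eventually_sign_eval₂_eq hR hS hU g (h.rootsLift hR hS _)
  have e : g.eval₂ ((germConst U).comp q) ((fun s => s : S → S) : Germ (U : Filter S) S)
      = ((fun s => g.eval₂ q s : S → S) : Germ (U : Filter S) S) := by
    have e : (fun s => g.eval₂ q s) = g.eval₂ ((Pi.constRingHom S S).comp q) (fun s => s) := by
      funext s
      exact (hom_eval₂ g ((Pi.constRingHom S S).comp q) (Pi.evalRingHom (fun _ => S) s)
        (fun s => s)).symm
    rw [e]
    exact (hom_eval₂ g ((Pi.constRingHom S S).comp q) (Germ.coeRingHom (U : Filter S))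
      (fun s => s)).symm
  rw [e]
  exact (sign_germ U (key.mono fun s hs => hs.symm)).symm

end Germ

section Transfer

open Filter

theorem polyIVT_real : PolyIVT ℝ := by
  intro f a b hab hneg
  rcases mul_neg_iff.1 hneg with ⟨h1, h2⟩ | ⟨h1, h2⟩
  · obtain ⟨c, hc, hc0⟩ := intermediate_value_Ioo' hab.le f.continuous.continuousOn ⟨h2, h1⟩
    exact ⟨c, hc.1, hc.2, hc0⟩
  · obtain ⟨c, hc, hc0⟩ := intermediate_value_Ioo hab.le f.continuous.continuousOn ⟨h1, h2⟩
    exact ⟨c, hc.1, hc.2, hc0⟩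

theorem sign_map_real {R : Type*} [Field R] [LinearOrder R] [IsStrictOrderedRing R]
    (f : ℝ →+* R) (r : ℝ) : SignType.sign (f r) = SignType.sign r := by
  have hpos : ∀ s : ℝ, 0 < s → 0 < f s := fun s hs => by
    rw [← Real.mul_self_sqrt hs.le, map_mul]
    exact mul_self_pos.2 ((map_ne_zero f).2 (Real.sqrt_pos.2 hs).ne')
  rcases lt_trichotomy r 0 with hr | rfl | hr
  · have := hpos (-r) (neg_pos.2 hr)
    rw [map_neg, neg_pos] at this
    rw [sign_neg hr, sign_neg this]
  · simp
  · rw [sign_pos hr, sign_pos (hpos r hr)]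

variable {R : Type*} [Field R] [LinearOrder R] [IsStrictOrderedRing R] {σ : Type*}

/-- Finitely many elements of a real closed extension `R` of `ℝ` are matched, with compatible
signs, in an ordered field `S` that satisfies a given implication between polynomial equations
valid over `ℝ`. -/
theorem exists_signPair_of_finset (hR : PolyIVT R) (f : ℝ →+* R) {P Q : MvPolynomial σ ℝ}
    (h : ∀ x, P.eval x = 0 → Q.eval x = 0) (Y : Finset R) :
    ∃ (S : Type) (_ : Field S) (_ : LinearOrder S) (_ : IsStrictOrderedRing S) (k : ℝ →+* S)
      (B : Subring (R × S)), PolyIVT S ∧ (∀ x, P.eval₂ k x = 0 → Q.eval₂ k x = 0) ∧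
      (∀ x ∈ B, SignType.sign x.1 = SignType.sign x.2) ∧ (∀ r, (f r, k r) ∈ B) ∧
      ∀ y ∈ Y, ∃ s, (y, s) ∈ B := by
  classical
  induction Y using Finset.induction_on with
  | empty =>
    refine ⟨ℝ, inferInstance, inferInstance, inferInstance, RingHom.id ℝ,
      (f.prod (RingHom.id ℝ)).range, polyIVT_real, h, ?_, fun r => ⟨r, rfl⟩, by simp⟩
    rintro _ ⟨r, rfl⟩
    exact sign_map_real f r
  | insert y Y _ ih =>
    obtain ⟨S, _, _, _, k, B₀, hS, hPQ, hsign, hreal, hY⟩ := ih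
    obtain ⟨B, hB₀, hB⟩ := exists_maximal_signPair hsign
    by_cases hy : ∃ b : B, (b : R × S).1 = y
    · refine ⟨S, inferInstance, inferInstance, inferInstance, k, B, hS, hPQ,
        fun x hx => hB.sign_eq ⟨x, hx⟩, fun r => hB₀ (hreal r), fun y' hy' => ?_⟩
      rcases Finset.mem_insert.1 hy' with rfl | hy'
      · obtain ⟨⟨⟨b, s⟩, hb⟩, rfl⟩ := hy
        exact ⟨s, hb⟩
      · obtain ⟨s, hs⟩ := hY y' hy'
        exact ⟨s, hB₀ hs⟩
    · push Not at hy
      obtain ⟨U, z, hz⟩ := hB.exists_germ hR hS hy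
      set p := (RingHom.fst R S).comp B.subtype with hp
      set q := (RingHom.snd R S).comp B.subtype with hq
      set ρ : B →+* R × Germ (U : Filter S) S := p.prod ((germConst U).comp q) with hρ
      have hmem : ∀ b : B, (p b, germConst U (q b)) ∈ (eval₂RingHom ρ (y, z)).range :=
        fun b => ⟨C b, by simp [hρ]⟩
      refine ⟨Germ (U : Filter S) S, inferInstance, inferInstance, inferInstance,
        (germConst U).comp k, (eval₂RingHom ρ (y, z)).range, hS.germ U, vanishing_germ U k hPQ,
        ?_, fun r => hmem ⟨_, hB₀ (hreal r)⟩, fun y' hy' => ?_⟩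
      · rintro _ ⟨g, rfl⟩
        rw [coe_eval₂RingHom]
        have e1 := hom_eval₂ g ρ (RingHom.fst R _) (y, z)
        have e2 := hom_eval₂ g ρ (RingHom.snd R _) (y, z)
        change (eval₂ ρ (y, z) g).1 = _ at e1
        change (eval₂ ρ (y, z) g).2 = _ at e2
        rw [e1, e2]
        exact hz g
      · rcases Finset.mem_insert.1 hy' with rfl | hy'
        · exact ⟨z, X, by simp⟩
        · obtain ⟨s, hs⟩ := hY y' hy'
          exact ⟨_, hmem ⟨_, hB₀ hs⟩⟩

theorem eval₂_eq_zero_of_polyIVT [Finite σ] (hR : PolyIVT R) (f : ℝ →+* R)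
    {P Q : MvPolynomial σ ℝ} (h : ∀ x, P.eval x = 0 → Q.eval x = 0) (x : σ → R)
    (hx : P.eval₂ f x = 0) : Q.eval₂ f x = 0 := by
  classical
  have := Fintype.ofFinite σ
  obtain ⟨S, _, _, _, k, B, -, hPQ, hsign, hreal, hY⟩ :=
    exists_signPair_of_finset hR f h (Finset.univ.image x)
  have hs : ∀ j, ∃ s, (x j, s) ∈ B := fun j => hY _ (Finset.mem_image_of_mem x (Finset.mem_univ j))
  choose s hs using hs
  have hcoord : ∀ T : MvPolynomial σ ℝ,
      SignType.sign (T.eval₂ f x) = SignType.sign (T.eval₂ k s) := by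
    intro T
    let ρ : ℝ →+* B := (f.prod k).codRestrict B hreal
    let b : σ → B := fun j => ⟨(x j, s j), hs j⟩
    have e1 := MvPolynomial.eval₂_comp_left ((RingHom.fst R S).comp B.subtype) ρ b T
    have e2 := MvPolynomial.eval₂_comp_left ((RingHom.snd R S).comp B.subtype) ρ b T
    have e3 := hsign _ (T.eval₂ ρ b).2
    change SignType.sign (((RingHom.fst R S).comp B.subtype) (T.eval₂ ρ b))
      = SignType.sign (((RingHom.snd R S).comp B.subtype) (T.eval₂ ρ b)) at e3
    rw [e1, e2] at e3
    exact e3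
  rw [← sign_eq_zero_iff, hcoord, sign_eq_zero_iff] at hx ⊢
  exact hPQ s hx

end Transfer

section PrimeCone

variable {A : Type*} [CommRing A]

/-- The sum of a subsemiring and a principal ideal. -/
def addSpan (T : Subsemiring A) (f : A) : Subsemiring A where
  carrier := {x | ∃ s ∈ T, f ∣ x - s}
  zero_mem' := ⟨0, T.zero_mem, by simp⟩
  one_mem' := ⟨1, T.one_mem, by simp⟩
  add_mem' := by
    rintro x y ⟨s, hs, hx⟩ ⟨t, ht, hy⟩
    exact ⟨s + t, T.add_mem hs ht, by simpa [add_sub_add_comm] using dvd_add hx hy⟩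
  mul_mem' := by
    rintro x y ⟨s, hs, hx⟩ ⟨t, ht, hy⟩
    refine ⟨s * t, T.mul_mem hs ht, ?_⟩
    have e : x * y - s * t = (x - s) * y + s * (y - t) := by ring
    rw [e]
    exact dvd_add (hx.mul_right y) (hy.mul_left s)

theorem le_addSpan (T : Subsemiring A) (f : A) : T ≤ addSpan T f :=
  fun s hs => ⟨s, hs, by simp⟩

theorem mem_addSpan_of_dvd (T : Subsemiring A) {f x : A} (h : f ∣ x) : x ∈ addSpan T f :=
  ⟨0, T.zero_mem, by simpa using h⟩

/-- The extension of a preordering by one element. -/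
def adjoinElem (T : Subsemiring A) (hsq : ∀ a, a * a ∈ T) (a : A) : Subsemiring A where
  carrier := {x | ∃ s ∈ T, ∃ t ∈ T, x = s + a * t}
  zero_mem' := ⟨0, T.zero_mem, 0, T.zero_mem, by simp⟩
  one_mem' := ⟨1, T.one_mem, 0, T.zero_mem, by simp⟩
  add_mem' := by
    rintro _ _ ⟨s, hs, t, ht, rfl⟩ ⟨s', hs', t', ht', rfl⟩
    exact ⟨s + s', T.add_mem hs hs', t + t', T.add_mem ht ht', by ring⟩
  mul_mem' := by
    rintro _ _ ⟨s, hs, t, ht, rfl⟩ ⟨s', hs', t', ht', rfl⟩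
    exact ⟨s * s' + a * a * (t * t'),
      T.add_mem (T.mul_mem hs hs') (T.mul_mem (hsq a) (T.mul_mem ht ht')),
      s * t' + s' * t, T.add_mem (T.mul_mem hs ht') (T.mul_mem hs' ht), by ring⟩

/-- A prime cone: a point of the real spectrum. -/
structure IsPrimeCone (T : Subsemiring A) : Prop where
  mem_or_neg_mem : ∀ a, a ∈ T ∨ -a ∈ T
  neg_one_notMem : -1 ∉ T
  prime : ∀ a b, a * b ∈ T → -(a * b) ∈ T → (a ∈ T ∧ -a ∈ T) ∨ (b ∈ T ∧ -b ∈ T)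

/-- The support of a prime cone. -/
def IsPrimeCone.support {T : Subsemiring A} (hT : IsPrimeCone T) : Ideal A where
  carrier := {a | a ∈ T ∧ -a ∈ T}
  zero_mem' := by simp
  add_mem' := by
    rintro a b ⟨ha, ha'⟩ ⟨hb, hb'⟩
    exact ⟨T.add_mem ha hb, by rw [neg_add]; exact T.add_mem ha' hb'⟩
  smul_mem' := by
    rintro c a ⟨ha, ha'⟩
    rcases hT.mem_or_neg_mem c with hc | hc
    · exact ⟨T.mul_mem hc ha, by rw [smul_eq_mul, ← mul_neg]; exact T.mul_mem hc ha'⟩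
    · exact ⟨by rw [smul_eq_mul, ← neg_mul_neg]; exact T.mul_mem hc ha',
        by rw [smul_eq_mul, ← neg_mul]; exact T.mul_mem hc ha⟩

theorem IsPrimeCone.mem_support {T : Subsemiring A} (hT : IsPrimeCone T) {a : A} :
    a ∈ hT.support ↔ a ∈ T ∧ -a ∈ T := Iff.rfl

theorem IsPrimeCone.isPrime_support {T : Subsemiring A} (hT : IsPrimeCone T) :
    hT.support.IsPrime where
  ne_top' h := hT.neg_one_notMem ((Ideal.eq_top_iff_one _).1 h).2
  mem_or_mem' {a b} h := hT.prime a b h.1 h.2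

theorem exists_isPrimeCone {T₀ : Subsemiring A} (hsq : ∀ a, a * a ∈ T₀) {q : A}
    (hq : ∀ m : ℕ, -(q ^ (2 * m)) ∉ T₀) :
    ∃ T, T₀ ≤ T ∧ IsPrimeCone T ∧ ∀ m : ℕ, -(q ^ (2 * m)) ∉ T := by
  obtain ⟨T, hT₀, hmax⟩ := zorn_le_nonempty₀
    {T : Subsemiring A | T₀ ≤ T ∧ ∀ m : ℕ, -(q ^ (2 * m)) ∉ T}
    (fun c hc hchain T hT => ⟨sSup c, ⟨(hc hT).1.trans (le_sSup hT), fun m hm => by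
      obtain ⟨T', hT', hm'⟩ :=
        (Subsemiring.mem_sSup_of_directedOn ⟨T, hT⟩ hchain.directedOn).1 hm
      exact (hc hT').2 m hm'⟩, fun T' hT' => le_sSup hT'⟩) T₀ ⟨le_rfl, hq⟩
  have hsqT : ∀ a, a * a ∈ T := fun a => hT₀ (hsq a)
  have hqT : ∀ m : ℕ, q ^ (2 * m) ∈ T := fun m => by
    rw [two_mul, pow_add]; exact hsqT _
  have hnot := hmax.prop.2
  have key : ∀ a, a ∉ T → ∃ m : ℕ, ∃ s ∈ T, ∃ t ∈ T, q ^ (2 * m) + s = -(a * t) := by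
    intro a ha
    by_contra! hcon
    have hle : T ≤ adjoinElem T hsqT a := fun s hs => ⟨s, hs, 0, T.zero_mem, by simp⟩
    refine ha (hmax.le_of_ge (y := adjoinElem T hsqT a) ⟨hT₀.trans hle, ?_⟩ hle
      ⟨0, T.zero_mem, 1, T.one_mem, by simp⟩)
    rintro m ⟨s, hs, t, ht, h⟩
    exact hcon m s hs t ht (by linear_combination -h)
  have contra : ∀ (m k : ℕ) (s s' c : A), s ∈ T → s' ∈ T → c ∈ T →
      (q ^ (2 * m) + s) * (q ^ (2 * k) + s') ≠ -c := by
    intro m k s s' c hs hs' hc h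
    apply hnot (m + k)
    have e : -(q ^ (2 * (m + k)))
        = c + q ^ (2 * m) * s' + s * q ^ (2 * k) + s * s' := by
      rw [mul_add, pow_add]; linear_combination -h
    rw [e]
    exact T.add_mem (T.add_mem (T.add_mem hc (T.mul_mem (hqT m) hs'))
      (T.mul_mem hs (hqT k))) (T.mul_mem hs hs')
  refine ⟨T, hT₀, ⟨fun a => ?_, fun h => hnot 0 (by simpa using h), fun a b hab hab' => ?_⟩, hnot⟩
  · by_contra! hcon
    obtain ⟨m, s, hs, t, ht, h⟩ := key a hcon.1
    obtain ⟨k, s', hs', t', ht', h'⟩ := key (-a) hcon.2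
    exact contra m k s s' (a * a * (t * t')) hs hs'
      (T.mul_mem (hsqT a) (T.mul_mem ht ht')) (by rw [h, h']; ring)
  · by_contra! hcon
    have hsgn : ∀ a : A, (a ∈ T → -a ∉ T) → ∃ m : ℕ, ∃ s ∈ T, ∃ t ∈ T, ∃ e : A, (e = a ∨ e = -a) ∧
        q ^ (2 * m) + s = e * t := by
      intro a ha
      by_cases haT : a ∈ T
      · obtain ⟨m, s, hs, t, ht, h⟩ := key (-a) (ha haT)
        exact ⟨m, s, hs, t, ht, a, Or.inl rfl, by rw [h]; ring⟩
      · obtain ⟨m, s, hs, t, ht, h⟩ := key a haT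
        exact ⟨m, s, hs, t, ht, -a, Or.inr rfl, by rw [h]; ring⟩
    obtain ⟨m, s, hs, t, ht, e, he, h⟩ := hsgn a hcon.1
    obtain ⟨k, s', hs', t', ht', e', he', h'⟩ := hsgn b hcon.2
    have hee : -(e * e') ∈ T := by
      rcases he with rfl | rfl <;> rcases he' with rfl | rfl <;> simpa
    exact contra m k s s' (-(e * e') * (t * t')) hs hs' (T.mul_mem hee (T.mul_mem ht ht'))
      (by rw [h, h']; ring)

end PrimeCone

section FieldCone

variable {L : Type*} [Field L]

/-- The nonnegative elements of an ordered subring of a field. -/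
structure IsFieldCone (T : Subsemiring L) : Prop where
  eq_zero : ∀ x, x ∈ T → -x ∈ T → x = 0
  sub_mem : ∀ x ∈ T, ∀ y ∈ T, x - y ∈ T ∨ y - x ∈ T

theorem IsPrimeCone.isFieldCone_map {A : Type*} [CommRing A] {T : Subsemiring A}
    (hT : IsPrimeCone T) (φ : A →+* L) (hφ : ∀ a, φ a = 0 ↔ a ∈ T ∧ -a ∈ T) :
    IsFieldCone (T.map φ) where
  eq_zero := by
    rintro _ ⟨a, ha, rfl⟩ ⟨b, hb, hab⟩
    have h := (hφ (a + b)).1 (by rw [map_add, hab, add_neg_cancel])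
    refine (hφ a).2 ⟨ha, ?_⟩
    have e : -a = b + -(a + b) := by ring
    rw [e]
    exact T.add_mem hb h.2
  sub_mem := by
    rintro _ ⟨a, ha, rfl⟩ _ ⟨b, hb, rfl⟩
    rcases hT.mem_or_neg_mem (a - b) with h | h
    · exact Or.inl ⟨_, h, map_sub φ a b⟩
    · exact Or.inr ⟨_, h, by rw [neg_sub, map_sub]⟩

theorem IsFieldCone.exists_maximal {T₀ : Subsemiring L} (h₀ : IsFieldCone T₀) :
    ∃ T, T₀ ≤ T ∧ Maximal IsFieldCone T := by
  refine zorn_le_nonempty₀ {T : Subsemiring L | IsFieldCone T} (fun c hc hchain T hT =>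
    ⟨sSup c, ?_, fun T' hT' => le_sSup hT'⟩) T₀ h₀
  have hmem : ∀ {x}, x ∈ sSup c ↔ ∃ T ∈ c, x ∈ T :=
    Subsemiring.mem_sSup_of_directedOn ⟨T, hT⟩ hchain.directedOn
  have hpair : ∀ x ∈ sSup c, ∀ y ∈ sSup c, ∃ T ∈ c, x ∈ T ∧ y ∈ T := by
    intro x hx y hy
    obtain ⟨T₁, hT₁, hx⟩ := hmem.1 hx
    obtain ⟨T₂, hT₂, hy⟩ := hmem.1 hy
    obtain ⟨T₃, hT₃, h13, h23⟩ := hchain.directedOn T₁ hT₁ T₂ hT₂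
    exact ⟨T₃, hT₃, h13 hx, h23 hy⟩
  constructor
  · intro x hx hx'
    obtain ⟨T', hT', h1, h2⟩ := hpair _ hx _ hx'
    exact (hc hT').eq_zero x h1 h2
  · intro x hx y hy
    obtain ⟨T', hT', h1, h2⟩ := hpair _ hx _ hy
    exact ((hc hT').sub_mem x h1 y h2).imp (fun h => le_sSup hT' h) fun h => le_sSup hT' h

/-- The fractions of the elements of a cone. -/
def IsFieldCone.fractions {T : Subsemiring L} : Subsemiring L where
  carrier := {x | ∃ b ∈ T, b ≠ 0 ∧ x * b ∈ T}
  zero_mem' := ⟨1, T.one_mem, one_ne_zero, by simp⟩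
  one_mem' := ⟨1, T.one_mem, one_ne_zero, by simp⟩
  add_mem' := by
    rintro x y ⟨b, hb, hb0, hx⟩ ⟨c, hc, hc0, hy⟩
    refine ⟨b * c, T.mul_mem hb hc, mul_ne_zero hb0 hc0, ?_⟩
    have e : (x + y) * (b * c) = x * b * c + y * c * b := by ring
    rw [e]
    exact T.add_mem (T.mul_mem hx hc) (T.mul_mem hy hb)
  mul_mem' := by
    rintro x y ⟨b, hb, hb0, hx⟩ ⟨c, hc, hc0, hy⟩
    refine ⟨b * c, T.mul_mem hb hc, mul_ne_zero hb0 hc0, ?_⟩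
    rw [mul_mul_mul_comm]
    exact T.mul_mem hx hy

theorem IsFieldCone.isFieldCone_fractions {T : Subsemiring L} (hT : IsFieldCone T) :
    IsFieldCone (fractions (T := T)) where
  eq_zero := by
    rintro x ⟨b, hb, hb0, hx⟩ ⟨c, hc, hc0, hx'⟩
    have h := hT.eq_zero (x * b * c) (T.mul_mem hx hc) (by
      have e : -(x * b * c) = -x * c * b := by ring
      rw [e]
      exact T.mul_mem hx' hb)
    simpa [hb0, hc0] using h
  sub_mem := by
    rintro x ⟨b, hb, hb0, hx⟩ y ⟨c, hc, hc0, hy⟩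
    have e1 : (x - y) * (b * c) = x * b * c - y * c * b := by ring
    have e2 : (y - x) * (b * c) = y * c * b - x * b * c := by ring
    exact (hT.sub_mem _ (T.mul_mem hx hc) _ (T.mul_mem hy hb)).imp
      (fun h => ⟨b * c, T.mul_mem hb hc, mul_ne_zero hb0 hc0, by rwa [e1]⟩)
      fun h => ⟨b * c, T.mul_mem hb hc, mul_ne_zero hb0 hc0, by rwa [e2]⟩

theorem inv_mem_of_maximal {T : Subsemiring L} (hT : Maximal IsFieldCone T) {x : L}
    (hx : x ∈ T) : x⁻¹ ∈ T := by
  rcases eq_or_ne x 0 with rfl | hx0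
  · simp
  · exact hT.le_of_ge hT.prop.isFieldCone_fractions
      (fun s hs => ⟨1, T.one_mem, one_ne_zero, by simpa using hs⟩)
      ⟨x, hx, hx0, by rw [inv_mul_cancel₀ hx0]; exact T.one_mem⟩

/-- The ordered subfield spanned by a maximal cone. -/
def coneField (T : Subsemiring L) (hT : Maximal IsFieldCone T) : Subfield L where
  carrier := {x | x ∈ T ∨ -x ∈ T}
  zero_mem' := Or.inl T.zero_mem
  one_mem' := Or.inl T.one_mem
  neg_mem' := by
    rintro x (h | h)
    · exact Or.inr (by simpa using h)
    · exact Or.inl h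
  add_mem' := by
    rintro x y (hx | hx) (hy | hy)
    · exact Or.inl (T.add_mem hx hy)
    · refine (hT.prop.sub_mem _ hx _ hy).imp (fun h => ?_) fun h => ?_
      · rwa [sub_neg_eq_add] at h
      · rwa [neg_add_rev, ← sub_eq_add_neg]
    · refine (hT.prop.sub_mem _ hy _ hx).imp (fun h => ?_) fun h => ?_
      · rwa [sub_neg_eq_add, add_comm] at h
      · rwa [neg_add']
    · exact Or.inr (by rw [neg_add]; exact T.add_mem hx hy)
  mul_mem' := by
    rintro x y (hx | hx) (hy | hy)
    · exact Or.inl (T.mul_mem hx hy)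
    · exact Or.inr (by rw [← mul_neg]; exact T.mul_mem hx hy)
    · exact Or.inr (by rw [← neg_mul]; exact T.mul_mem hx hy)
    · exact Or.inl (by rw [← neg_mul_neg]; exact T.mul_mem hx hy)
  inv_mem' := by
    rintro x (hx | hx)
    · exact Or.inl (inv_mem_of_maximal hT hx)
    · exact Or.inr (by rw [← inv_neg]; exact inv_mem_of_maximal hT hx)

open Classical in
/-- The order on the subfield spanned by a maximal cone. -/
noncomputable abbrev coneOrder (T : Subsemiring L) (hT : Maximal IsFieldCone T) :
    LinearOrder (coneField T hT) where
  le x y := (y - x : L) ∈ T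
  le_refl x := by simp
  le_trans x y z h1 h2 := by simpa using T.add_mem h2 h1
  le_antisymm x y h1 h2 :=
    Subtype.ext (sub_eq_zero.1 (hT.prop.eq_zero _ h2 (by rwa [neg_sub])))
  le_total x y := by
    rcases (y - x).2 with h | h
    · exact Or.inl h
    · exact Or.inr (by simpa using h)
  toDecidableLE := fun _ _ => Classical.propDecidable _

theorem coneOrder_isStrictOrderedRing (T : Subsemiring L) (hT : Maximal IsFieldCone T) :
    letI := coneOrder T hT
    IsStrictOrderedRing (coneField T hT) := by
  let := coneOrder T hT
  have hnonneg : ∀ x : coneField T hT, 0 ≤ x ↔ (x : L) ∈ T := fun x => by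
    change ((x : L) - ((0 : coneField T hT) : L)) ∈ T ↔ _
    simp
  have : IsOrderedAddMonoid (coneField T hT) :=
    { add_le_add_left := fun a b hab c => by
        change ((b : L) + c - (a + c)) ∈ T
        rw [add_sub_add_right_eq_sub]
        exact hab }
  have : ZeroLEOneClass (coneField T hT) := ⟨(hnonneg 1).2 T.one_mem⟩
  refine IsStrictOrderedRing.of_mul_pos fun a b ha hb => ?_
  refine lt_of_le_of_ne ((hnonneg _).2 ?_) (mul_ne_zero ha.ne' hb.ne').symm
  exact T.mul_mem ((hnonneg a).1 ha.le) ((hnonneg b).1 hb.le)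

end FieldCone

section RealClosed

universe u

variable {R L : Type*} [Field R] [LinearOrder R] [IsStrictOrderedRing R] [Field L]

variable (R) in
/-- The squares of polynomials multiplied by nonnegative constants. -/
def weightedSquares : Submonoid R[X] where
  carrier := {x | ∃ (t : R) (h : R[X]), 0 ≤ t ∧ x = C t * (h * h)}
  one_mem' := ⟨1, 1, zero_le_one, by simp⟩
  mul_mem' := by
    rintro _ _ ⟨t, h, ht, rfl⟩ ⟨t', h', ht', rfl⟩
    exact ⟨t * t', h * h', mul_nonneg ht ht', by rw [C_mul]; ring⟩

theorem exists_nonneg_remainder {f : R[X]} (hf : f.natDegree ≠ 0) {s : R[X]}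
    (hs : s ∈ (weightedSquares R).subsemiringClosure) :
    ∃ r : R[X], f ∣ s - r ∧ r.natDegree ≤ 2 * (f.natDegree - 1) ∧ ∀ w, 0 ≤ r.eval w := by
  replace hs : s ∈ AddSubmonoid.closure (weightedSquares R : Set R[X]) := hs
  induction hs using AddSubmonoid.closure_induction with
  | zero => exact ⟨0, by simp, by simp, by simp⟩
  | add x y _ _ hx hy =>
    obtain ⟨r, h1, h2, h3⟩ := hx
    obtain ⟨r', h1', h2', h3'⟩ := hy
    refine ⟨r + r', ?_, (natDegree_add_le _ _).trans (max_le h2 h2'), fun w => ?_⟩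
    · rw [add_sub_add_comm]; exact dvd_add h1 h1'
    · rw [eval_add]; exact add_nonneg (h3 w) (h3' w)
  | mem x hx =>
    obtain ⟨t, h, ht, rfl⟩ := hx
    refine ⟨C t * (h % f * (h % f)), ?_, ?_, fun w => ?_⟩
    · have e : C t * (h * h) - C t * (h % f * (h % f)) = (h - h % f) * (C t * (h + h % f)) := by
        ring
      rw [e]
      exact Dvd.dvd.mul_right ⟨h / f, by linear_combination -EuclideanDomain.div_add_mod h f⟩ _
    · have := natDegree_mod_lt h hf
      refine (natDegree_C_mul_le _ _).trans (natDegree_mul_le.trans ?_)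
      omega
    · simp only [eval_mul, eval_C]
      exact mul_nonneg ht (mul_self_nonneg _)

theorem neg_one_notMem_addSpan {f : R[X]} (hf : f.natDegree ≠ 0) {u v : R}
    (huv : f.eval u * f.eval v < 0)
    (ih : ∀ q : R[X], q.natDegree < f.natDegree → q.eval u * q.eval v < 0 → ∃ w, q.eval w = 0) :
    -1 ∉ addSpan (weightedSquares R).subsemiringClosure f := by
  rintro ⟨s, hs, hfs⟩
  obtain ⟨r, hr, hdeg, hnn⟩ := exists_nonneg_remainder hf hs
  obtain ⟨q, hq⟩ : f ∣ -1 - r := by simpa using dvd_add hfs hr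
  have hev : ∀ w, f.eval w * q.eval w = -1 - r.eval w := fun w => by
    rw [← eval_mul, ← hq]; simp
  have hneg : ∀ w, f.eval w * q.eval w < 0 := fun w => by
    rw [hev]; linarith [hnn w]
  have hf0 : f ≠ 0 := by rintro rfl; simp at hf
  have hq0 : q ≠ 0 := by
    rintro rfl
    simpa using hneg u
  have hqdeg : q.natDegree < f.natDegree := by
    have h1 := natDegree_mul hf0 hq0
    rw [← hq] at h1
    have h2 : (-1 - r).natDegree ≤ 2 * (f.natDegree - 1) :=
      (natDegree_sub_le _ _).trans (max_le (by simp) hdeg)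
    omega
  have hquv : q.eval u * q.eval v < 0 := by
    by_contra hcon
    have h1 := mul_pos_of_neg_of_neg (hneg u) (hneg v)
    nlinarith
  obtain ⟨w, hw⟩ := ih q hqdeg hquv
  simpa [hw] using hneg w

/-- An ordered field whose order does not extend to larger subfields of an algebraically closed
field has the intermediate value property for polynomials. -/
theorem polyIVT_of_maximal [IsAlgClosed L] (j : R →+* L)
    (hmax : ∀ T : Subsemiring L, IsFieldCone T → (∀ r, 0 ≤ r → j r ∈ T) →
      ∀ x ∈ T, ∃ r, j r = x) : PolyIVT R := by
  intro f u v huv hf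
  induction hd : f.natDegree using Nat.strong_induction_on generalizing f with
  | _ d ih =>
  subst hd
  have hf0 : f ≠ 0 := by rintro rfl; simp at hf
  have hdeg : f.natDegree ≠ 0 := by
    intro h
    obtain ⟨c, rfl⟩ := natDegree_eq_zero.1 h
    simp only [eval_C] at hf
    exact (mul_self_nonneg c).not_gt hf
  have hunit : ¬ IsUnit f := fun h => hdeg (natDegree_eq_zero_of_isUnit h)
  by_cases hirr : Irreducible f
  · have hcone := neg_one_notMem_addSpan hdeg hf fun q hq hquv =>
      let ⟨w, _, _, hw⟩ := ih _ hq q hquv rfl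
      ⟨w, hw⟩
    have hle := le_addSpan (weightedSquares R).subsemiringClosure f
    have hgen : ∀ (t : R) (h : R[X]), 0 ≤ t →
        C t * (h * h) ∈ (weightedSquares R).subsemiringClosure := fun t h ht =>
      AddSubmonoid.subset_closure ⟨t, h, ht, rfl⟩
    obtain ⟨T, hT, hprime, -⟩ := exists_isPrimeCone (q := 1)
      (fun a => hle (by simpa using hgen 1 a zero_le_one)) (fun m => by simpa using hcone)
    have hfT : f ∈ hprime.support :=
      ⟨hT (mem_addSpan_of_dvd _ dvd_rfl), hT (mem_addSpan_of_dvd _ (dvd_neg.2 dvd_rfl))⟩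
    obtain ⟨α, hα⟩ := IsAlgClosed.exists_eval₂_eq_zero j f fun h =>
      hdeg (natDegree_eq_zero_iff_degree_le_zero.2 h.le)
    have hφ : ∀ h : R[X], eval₂RingHom j α h = 0 ↔ h ∈ hprime.support := by
      intro h
      rcases (EuclideanDomain.dvd_or_coprime f h hirr).symm with hco | ⟨k, rfl⟩
      · obtain ⟨a, b, hab⟩ := hco
        constructor
        · intro h0
          have := congrArg (eval₂RingHom j α) hab
          rw [map_add, map_mul, map_mul, h0, coe_eval₂RingHom, hα] at this
          simp at this
        · intro hmem
          refine absurd ?_ hprime.isPrime_support.one_notMem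
          rw [← hab]
          exact add_mem (Ideal.mul_mem_left _ _ hfT) (Ideal.mul_mem_left _ _ hmem)
      · refine ⟨fun _ => Ideal.mul_mem_right _ _ hfT, fun _ => ?_⟩
        rw [map_mul, coe_eval₂RingHom, hα, zero_mul]
    have hcone' := hprime.isFieldCone_map (eval₂RingHom j α) hφ
    have hroot : ∃ r, j r = α := by
      have hmax' := hmax _ hcone' fun r hr =>
        ⟨C r, hT (hle (by simpa using hgen r 1 hr)), by simp⟩
      rcases hprime.mem_or_neg_mem X with h | h
      · exact hmax' _ ⟨X, h, by simp⟩
      · obtain ⟨r, hr⟩ := hmax' (-α) ⟨-X, h, by simp⟩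
        exact ⟨-r, by rw [map_neg, hr, neg_neg]⟩
    obtain ⟨r, rfl⟩ := hroot
    have hr : f.eval r = 0 := j.injective (by rw [map_zero, ← hα, eval₂_at_apply])
    obtain ⟨k, rfl⟩ := dvd_iff_isRoot.2 hr
    have hk : IsUnit k := (hirr.isUnit_or_isUnit rfl).resolve_left (not_isUnit_X_sub_C r)
    obtain ⟨c, -, rfl⟩ := isUnit_iff.1 hk
    have h : (r - u) * (v - r) * (c * c) > 0 := by
      simp at hf; nlinarith
    have h' : 0 < (r - u) * (v - r) := pos_of_mul_pos_left h (mul_self_nonneg c)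
    refine ⟨r, ?_, ?_, hr⟩
    · by_contra hcon
      nlinarith
    · by_contra hcon
      nlinarith
  · obtain ⟨g, k, rfl, hg, hk⟩ : ∃ g k, f = g * k ∧ ¬ IsUnit g ∧ ¬ IsUnit k := by
      by_contra! hcon
      exact hirr ⟨hunit, fun g k h => or_iff_not_imp_left.2 fun hg => hcon g k h hg⟩
    have hg0 := left_ne_zero_of_mul hf0
    have hk0 := right_ne_zero_of_mul hf0
    have hpos : ∀ g : R[X], ¬ IsUnit g → g ≠ 0 → 0 < g.natDegree := fun g hg hg0 =>
      natDegree_pos_iff_degree_pos.2 (degree_pos_of_ne_zero_of_nonunit hg0 hg)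
    have hgd := hpos g hg hg0
    have hkd := hpos k hk hk0
    have hadd := natDegree_mul hg0 hk0
    rw [eval_mul, eval_mul, mul_mul_mul_comm] at hf
    rcases mul_neg_iff.1 hf with ⟨-, h⟩ | ⟨h, -⟩
    · obtain ⟨c, h1, h2, hc⟩ := ih k.natDegree (by omega) k h rfl
      exact ⟨c, h1, h2, by simp [hc]⟩
    · obtain ⟨c, h1, h2, hc⟩ := ih g.natDegree (by omega) g h rfl
      exact ⟨c, h1, h2, by simp [hc]⟩

/-- A point of the real spectrum is realised in a field with the intermediate value property. -/
theorem IsPrimeCone.exists_polyIVT {A : Type u} [CommRing A] {T : Subsemiring A}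
    (hT : IsPrimeCone T) : ∃ (L : Type u) (_ : Field L) (K : Subfield L) (_ : LinearOrder K)
      (_ : IsStrictOrderedRing K) (f : A →+* K), PolyIVT K ∧ ∀ a, f a = 0 ↔ a ∈ T ∧ -a ∈ T := by
  have := hT.isPrime_support
  let L := AlgebraicClosure (FractionRing (A ⧸ hT.support))
  let φ : A →+* L := (algebraMap (FractionRing (A ⧸ hT.support)) L).comp
    ((algebraMap (A ⧸ hT.support) _).comp (Ideal.Quotient.mk hT.support))
  have hφ : ∀ a, φ a = 0 ↔ a ∈ T ∧ -a ∈ T := fun a => by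
    simp only [φ, RingHom.comp_apply, map_eq_zero]
    rw [FaithfulSMul.algebraMap_eq_zero_iff, Ideal.Quotient.eq_zero_iff_mem, hT.mem_support]
  obtain ⟨M, hM, hmax⟩ := (hT.isFieldCone_map φ hφ).exists_maximal
  have hmem : ∀ a, φ a ∈ coneField M hmax := fun a =>
    (hT.mem_or_neg_mem a).imp (fun h => hM ⟨a, h, rfl⟩) fun h => hM ⟨-a, h, map_neg φ a⟩
  refine ⟨L, inferInstance, coneField M hmax, coneOrder M hmax,
    coneOrder_isStrictOrderedRing M hmax, φ.codRestrict _ hmem, ?_, fun a => ?_⟩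
  · let := coneOrder M hmax
    have := coneOrder_isStrictOrderedRing M hmax
    refine polyIVT_of_maximal (coneField M hmax).subtype fun T' hT' hpos x hx => ?_
    have hle : M ≤ T' := fun y hy => hpos ⟨y, Or.inl hy⟩ (by
      change (y - ((0 : coneField M hmax) : L)) ∈ M
      simpa using hy)
    exact ⟨⟨x, Or.inl (hmax.le_of_ge hT' hle hx)⟩, rfl⟩
  · rw [← hφ, ← Subtype.coe_inj]
    rfl

end RealClosed

section Nullstellensatz

variable {A : Type*} [CommRing A]

variable (A) in
/-- The subsemiring of sums of squares. -/
def sumsOfSquares : Subsemiring A :=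
  (MonoidHom.mrange (powMonoidHom 2 : A →* A)).subsemiringClosure

theorem mul_self_mem_sumsOfSquares (a : A) : a * a ∈ sumsOfSquares A :=
  AddSubmonoid.subset_closure ⟨a, pow_two a⟩

/-- The real Nullstellensatz for a principal ideal. -/
theorem exists_neg_pow_mem_addSpan {σ : Type*} [Finite σ] {P Q : MvPolynomial σ ℝ}
    (h : ∀ x, P.eval x = 0 → Q.eval x = 0) :
    ∃ m : ℕ, -(Q ^ (2 * m)) ∈ addSpan (sumsOfSquares (MvPolynomial σ ℝ)) P := by
  by_contra! hcon
  obtain ⟨T, hle, hT, hQ⟩ := exists_isPrimeCone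
    (fun a => le_addSpan _ P (mul_self_mem_sumsOfSquares a)) hcon
  obtain ⟨L, _, K, _, _, f, hK, hf⟩ := hT.exists_polyIVT
  have heval : ∀ F : MvPolynomial σ ℝ,
      F.eval₂ (f.comp MvPolynomial.C) (fun i => f (MvPolynomial.X i)) = f F := fun F => by
    have := MvPolynomial.eval₂_comp_left f MvPolynomial.C MvPolynomial.X F
    rw [MvPolynomial.eval₂_eta] at this
    exact this.symm
  have hP : f P = 0 := (hf P).2
    ⟨hle (mem_addSpan_of_dvd _ dvd_rfl), hle (mem_addSpan_of_dvd _ (dvd_neg.2 dvd_rfl))⟩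
  have hQ0 : f Q = 0 := by
    rw [← heval] at hP ⊢
    exact eval₂_eq_zero_of_polyIVT hK _ h _ hP
  exact hQ 1 ((hf _).1 (by rw [map_pow, hQ0]; simp)).2

end Nullstellensatz

section Functional

variable {A : Type*} [CommRing A] [Algebra ℝ A] {Λ : A →ₗ[ℝ] ℝ}

theorem map_mul_eq_zero_of_map_sq (hΛ : ∀ a, 0 ≤ Λ (a ^ 2)) {a : A} (ha : Λ (a ^ 2) = 0)
    (b : A) : Λ (a * b) = 0 := by
  have key : ∀ t : ℝ, 0 ≤ Λ (b ^ 2) + 2 * t * Λ (a * b) := fun t => by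
    have h := hΛ (t • a + b)
    have e : (t • a + b) ^ 2 = (t ^ 2) • a ^ 2 + (b ^ 2 + (2 * t) • (a * b)) := by
      simp only [Algebra.smul_def, map_mul, map_pow, map_ofNat]
      ring
    rw [e] at h
    simpa [ha] using h
  by_contra hne
  have h := key (-(Λ (b ^ 2) + 1) / (2 * Λ (a * b)))
  have e : 2 * (-(Λ (b ^ 2) + 1) / (2 * Λ (a * b))) * Λ (a * b) = -(Λ (b ^ 2) + 1) := by
    field_simp
  linarith

theorem map_eq_zero_of_map_pow_sq (hΛ : ∀ a, 0 ≤ Λ (a ^ 2)) {a : A} (m : ℕ)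
    (ha : Λ ((a ^ m) ^ 2) = 0) : Λ a = 0 := by
  have hsucc : Λ ((a ^ (m + 1)) ^ 2) = 0 := by
    have e : (a ^ (m + 1)) ^ 2 = a ^ m * (a ^ m * a ^ 2) := by ring
    rw [e]
    exact map_mul_eq_zero_of_map_sq hΛ ha _
  clear ha
  induction m with
  | zero => simpa using map_mul_eq_zero_of_map_sq hΛ hsucc 1
  | succ k ih =>
    refine ih ?_
    have e : (a ^ (k + 1)) ^ 2 = a ^ (k + 1 + 1) * a ^ k := by ring
    rw [e]
    exact map_mul_eq_zero_of_map_sq hΛ hsucc _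

theorem map_nonneg_of_mem_addSpan (hΛ : ∀ a, 0 ≤ Λ (a ^ 2)) {f : A} (hf : ∀ a, f ∣ a → Λ a = 0)
    {x : A} (hx : x ∈ addSpan (sumsOfSquares A) f) : 0 ≤ Λ x := by
  obtain ⟨s, hs, hdvd⟩ := hx
  have hs' : 0 ≤ Λ s := by
    clear hdvd
    replace hs : s ∈ AddSubmonoid.closure (MonoidHom.mrange (powMonoidHom 2 : A →* A) : Set A) := hs
    induction hs using AddSubmonoid.closure_induction with
    | zero => simp
    | add y z _ _ hy hz => rw [map_add]; exact add_nonneg hy hz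
    | mem y hy =>
      obtain ⟨a, rfl⟩ := hy
      exact hΛ a
  have h := hf _ hdvd
  rw [map_sub, sub_eq_zero] at h
  rwa [h]

theorem map_eq_zero_of_forall_eval {σ : Type*} [Finite σ] {Λ : MvPolynomial σ ℝ →ₗ[ℝ] ℝ}
    (hΛ : ∀ F, 0 ≤ Λ (F ^ 2)) {P Q : MvPolynomial σ ℝ} (hP : ∀ F, P ∣ F → Λ F = 0)
    (h : ∀ x, P.eval x = 0 → Q.eval x = 0) : Λ Q = 0 := by
  obtain ⟨m, hm⟩ := exists_neg_pow_mem_addSpan h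
  have hle := map_nonneg_of_mem_addSpan hΛ hP hm
  rw [map_neg, mul_comm, pow_mul] at hle
  exact map_eq_zero_of_map_pow_sq hΛ m (le_antisymm (by linarith) (hΛ _))

end Functional

end RealNullstellensatz

theorem stmt_2 (n : ℕ) (hn : 0 < n) (P : MvPolynomial (Fin n) ℝ) :
    IsTypeAR P ↔
      (∀ Λ : MvPolynomial (Fin n) ℝ →ₗ[ℝ] ℝ, IsPosDefR Λ →
        VanishesOnR Λ (vanishingIdealR (zSetR P)) → IsMomentR Λ) := by
  refine ⟨fun h Λ hΛ hvan => h Λ hΛ fun F hF => hvan F ?_,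
    fun h Λ hΛ hvan => h Λ hΛ fun Q hQ => ?_⟩
  · exact (Ideal.span_singleton_le_iff_mem _).2 (fun x hx => hx) hF
  · exact RealNullstellensatz.map_eq_zero_of_forall_eval hΛ
      (fun F hF => hvan F (Ideal.mem_span_singleton.2 hF)) hQ
end

section
/- Let P, Q ∈ ℂ[X₁,…,Xₙ] be such that Z_P = Z_Q. Then P is of type A if and only if Q is of type A; that is, every positive definite linear functional on ℂ[X₁,…,Xₙ] vanishing on the ideal (P) is a moment functional if and only if every positive definite linear functional vanishing on the ideal (Q) is a moment functional. -/
open MeasureTheory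
open scoped ComplexOrder

noncomputable def evalC {n : ℕ} (P : MvPolynomial (Fin n) ℂ) (x : Fin n → ℝ) : ℂ :=
  MvPolynomial.aeval (fun i => (x i : ℂ)) P

noncomputable def starC {n : ℕ} (P : MvPolynomial (Fin n) ℂ) : MvPolynomial (Fin n) ℂ :=
  MvPolynomial.map (starRingEnd ℂ) P

def IsPosDefC {n : ℕ} (Λ : MvPolynomial (Fin n) ℂ →ₗ[ℂ] ℂ) : Prop :=
  ∀ P : MvPolynomial (Fin n) ℂ, 0 ≤ Λ (starC P * P)

def IsMomentC {n : ℕ} (Λ : MvPolynomial (Fin n) ℂ →ₗ[ℂ] ℂ) : Prop :=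
  ∃ μ : Measure (Fin n → ℝ),
    (∀ Q : MvPolynomial (Fin n) ℂ, Integrable (fun x => evalC Q x) μ) ∧
    (∀ Q : MvPolynomial (Fin n) ℂ, Λ Q = ∫ x, evalC Q x ∂μ)

noncomputable def vanishingIdealC {n : ℕ} (Z : Set (Fin n → ℝ)) :
    Ideal (MvPolynomial (Fin n) ℂ) where
  carrier := {P | ∀ x ∈ Z, evalC P x = 0}
  add_mem' := by
    intro a b ha hb x hx
    simp only [Set.mem_setOf_eq, evalC, map_add] at *
    rw [ha x hx, hb x hx, add_zero]
  zero_mem' := by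
    intro x hx
    simp [evalC]
  smul_mem' := by
    intro c a ha x hx
    simp only [Set.mem_setOf_eq, evalC, smul_eq_mul, map_mul] at *
    rw [ha x hx, mul_zero]

def zeroSetC {n : ℕ} (I : Ideal (MvPolynomial (Fin n) ℂ)) : Set (Fin n → ℝ) :=
  {x | ∀ P ∈ I, evalC P x = 0}

def zSetC {n : ℕ} (P : MvPolynomial (Fin n) ℂ) : Set (Fin n → ℝ) :=
  {x | evalC P x = 0}

def VanishesOnC {n : ℕ} (Λ : MvPolynomial (Fin n) ℂ →ₗ[ℂ] ℂ)
    (I : Ideal (MvPolynomial (Fin n) ℂ)) : Prop :=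
  ∀ P ∈ I, Λ P = 0

def nSetC {n : ℕ} (Λ : MvPolynomial (Fin n) ℂ →ₗ[ℂ] ℂ) : Set (MvPolynomial (Fin n) ℂ) :=
  {P | Λ (starC P * P) = 0}

def IsTypeAC {n : ℕ} (P : MvPolynomial (Fin n) ℂ) : Prop :=
  ∀ Λ : MvPolynomial (Fin n) ℂ →ₗ[ℂ] ℂ,
    IsPosDefC Λ → VanishesOnC Λ (Ideal.span {P}) → IsMomentC Λ

/-- A preordering of a field, given by its set of nonnegative elements. -/
structure IsFieldPreordering {F : Type*} [Field F] (T : Set F) : Prop where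
  add : ∀ {x y}, x ∈ T → y ∈ T → x + y ∈ T
  mul : ∀ {x y}, x ∈ T → y ∈ T → x * y ∈ T
  mul_self : ∀ x, x * x ∈ T
  neg_one : -1 ∉ T

theorem IsFieldPreordering.exists_total {F : Type*} [Field F] {T : Set F}
    (hT : IsFieldPreordering T) :
    ∃ P, T ⊆ P ∧ IsFieldPreordering P ∧ ∀ x, x ∈ P ∨ -x ∈ P := by
  obtain ⟨P, hTP, hP⟩ := zorn_subset_nonempty {P : Set F | IsFieldPreordering P} (by
    intro c hc hchain ⟨s₀, hs₀⟩
    refine ⟨⋃₀ c, ⟨?_, ?_, ?_, ?_⟩, fun s hs => Set.subset_sUnion_of_mem hs⟩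
    · rintro x y ⟨s, hs, hx⟩ ⟨t, ht, hy⟩
      obtain ⟨u, hu, hsu, htu⟩ := hchain.directedOn s hs t ht
      exact ⟨u, hu, (hc hu).add (hsu hx) (htu hy)⟩
    · rintro x y ⟨s, hs, hx⟩ ⟨t, ht, hy⟩
      obtain ⟨u, hu, hsu, htu⟩ := hchain.directedOn s hs t ht
      exact ⟨u, hu, (hc hu).mul (hsu hx) (htu hy)⟩
    · exact fun x => ⟨s₀, hs₀, (hc hs₀).mul_self x⟩
    · rintro ⟨s, hs, h⟩
      exact (hc hs).neg_one h) T hT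
  have hPp : IsFieldPreordering P := hP.prop
  have h0 : (0 : F) ∈ P := by simpa using hPp.mul_self 0
  have h1 : (1 : F) ∈ P := by simpa using hPp.mul_self 1
  refine ⟨P, hTP, hPp, fun x => or_iff_not_imp_left.2 fun hx => ?_⟩
  have hP' : IsFieldPreordering {z | ∃ p ∈ P, ∃ q ∈ P, z = p - q * x} := by
    refine ⟨?_, ?_, ?_, ?_⟩
    · rintro _ _ ⟨p, hp, q, hq, rfl⟩ ⟨r, hr, s, hs, rfl⟩
      exact ⟨p + r, hPp.add hp hr, q + s, hPp.add hq hs, by ring⟩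
    · rintro _ _ ⟨p, hp, q, hq, rfl⟩ ⟨r, hr, s, hs, rfl⟩
      exact ⟨p * r + q * s * (x * x),
        hPp.add (hPp.mul hp hr) (hPp.mul (hPp.mul hq hs) (hPp.mul_self x)), p * s + q * r,
        hPp.add (hPp.mul hp hs) (hPp.mul hq hr), by ring⟩
    · exact fun y => ⟨y * y, hPp.mul_self y, 0, h0, by ring⟩
    · rintro ⟨p, hp, q, hq, h⟩
      by_cases hq0 : q = 0
      · subst hq0
        exact hPp.neg_one (by rw [h]; simpa using hp)
      · apply hx
        have hxe : x = (1 + p) * q * (q⁻¹ * q⁻¹) := by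
          field_simp
          linear_combination h
        rw [hxe]
        exact hPp.mul (hPp.mul (hPp.add h1 hp) hq) (hPp.mul_self _)
  exact hP.le_of_ge hP' (fun p hp => ⟨p, hp, 0, h0, by ring⟩) ⟨0, h0, 1, h1, by ring⟩

/-- The nonnegative part of some ordered subfield of a field. -/
structure IsSubfieldCone {F : Type*} [Field F] (P : Set F) : Prop where
  one : 1 ∈ P
  add : ∀ {x y}, x ∈ P → y ∈ P → x + y ∈ P
  mul : ∀ {x y}, x ∈ P → y ∈ P → x * y ∈ P
  inv : ∀ {x}, x ∈ P → x⁻¹ ∈ P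
  sub : ∀ {x y}, x ∈ P → y ∈ P → x - y ∈ P ∨ y - x ∈ P
  neg_one : -1 ∉ P

theorem IsFieldPreordering.isSubfieldCone {F : Type*} [Field F] {P : Set F}
    (hP : IsFieldPreordering P) (htot : ∀ x, x ∈ P ∨ -x ∈ P) : IsSubfieldCone P where
  one := by simpa using hP.mul_self 1
  add := hP.add
  mul := hP.mul
  inv := by
    intro x hx
    by_cases h0 : x = 0
    · simpa [h0] using hx
    · have : x⁻¹ = x * (x⁻¹ * x⁻¹) := by field_simp
      rw [this]
      exact hP.mul hx (hP.mul_self _)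
  sub := by
    intro x y _ _
    simpa using htot (x - y)
  neg_one := hP.neg_one

namespace IsSubfieldCone

variable {F : Type*} [Field F] {P : Set F} (hP : IsSubfieldCone P)
include hP

theorem zero : (0 : F) ∈ P := by simpa using hP.sub hP.one hP.one

theorem eq_zero {x : F} (hx : x ∈ P) (hx' : -x ∈ P) : x = 0 := by
  by_contra h
  apply hP.neg_one
  have := hP.mul hx' (hP.inv hx)
  rwa [neg_mul, mul_inv_cancel₀ h] at this

theorem image {E : Type*} [Field E] (f : F →+* E) : IsSubfieldCone (f '' P) where
  one := ⟨1, hP.one, map_one f⟩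
  add := by
    rintro _ _ ⟨x, hx, rfl⟩ ⟨y, hy, rfl⟩
    exact ⟨x + y, hP.add hx hy, map_add f x y⟩
  mul := by
    rintro _ _ ⟨x, hx, rfl⟩ ⟨y, hy, rfl⟩
    exact ⟨x * y, hP.mul hx hy, map_mul f x y⟩
  inv := by
    rintro _ ⟨x, hx, rfl⟩
    exact ⟨x⁻¹, hP.inv hx, map_inv₀ f x⟩
  sub := by
    rintro _ _ ⟨x, hx, rfl⟩ ⟨y, hy, rfl⟩
    exact (hP.sub hx hy).imp (fun h => ⟨_, h, map_sub f _ _⟩) (fun h => ⟨_, h, map_sub f _ _⟩)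
  neg_one := by
    rintro ⟨x, hx, h⟩
    have : x = -1 := f.injective (by simpa using h)
    exact hP.neg_one (this ▸ hx)

omit hP in
/-- The subfield ordered by a cone. -/
def subfield (hP : IsSubfieldCone P) : Subfield F where
  carrier := {x | x ∈ P ∨ -x ∈ P}
  one_mem' := Or.inl hP.one
  zero_mem' := Or.inl hP.zero
  neg_mem' := by
    rintro x (hx | hx)
    · exact Or.inr (by simpa using hx)
    · exact Or.inl hx
  add_mem' := by
    rintro x y (hx | hx) (hy | hy)
    · exact Or.inl (hP.add hx hy)
    · rcases hP.sub hx hy with h | h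
      · exact Or.inl (by simpa using h)
      · exact Or.inr (by convert h using 1; ring)
    · rcases hP.sub hx hy with h | h
      · exact Or.inr (by convert h using 1; ring)
      · exact Or.inl (by convert h using 1; ring)
    · exact Or.inr (by convert hP.add hx hy using 1; ring)
  mul_mem' := by
    rintro x y (hx | hx) (hy | hy)
    · exact Or.inl (hP.mul hx hy)
    · exact Or.inr (by simpa using hP.mul hx hy)
    · exact Or.inr (by simpa using hP.mul hx hy)
    · exact Or.inl (by simpa using hP.mul hx hy)
  inv_mem' := by
    rintro x (hx | hx)
    · exact Or.inl (hP.inv hx)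
    · exact Or.inr (by simpa using hP.inv hx)

omit hP in
/-- The order on the subfield ordered by a cone. -/
noncomputable abbrev linearOrder (hP : IsSubfieldCone P) : LinearOrder hP.subfield where
  le a b := (b : F) - a ∈ P
  le_refl a := by simpa using hP.zero
  le_trans a b c hab hbc := by
    have := hP.add hab hbc
    simpa using this
  le_antisymm a b hab hba := by
    have := hP.eq_zero hab (by simpa using hba)
    exact Subtype.ext (sub_eq_zero.1 this).symm
  le_total a b := by
    rcases (hP.subfield.sub_mem b.2 a.2) with h | h
    · exact Or.inl h
    · exact Or.inr (by simpa using h)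
  toDecidableLE := Classical.decRel _

theorem isStrictOrderedRing :
    let _ := hP.linearOrder
    IsStrictOrderedRing hP.subfield := by
  let _ := hP.linearOrder
  have hle : ∀ a b : hP.subfield, a ≤ b ↔ (b : F) - a ∈ P := fun _ _ => Iff.rfl
  have : IsOrderedAddMonoid hP.subfield :=
    { add_le_add_left := fun a b h c => by
        rw [hle] at h ⊢
        simpa using h }
  have : ZeroLEOneClass hP.subfield := ⟨by rw [hle]; simpa using hP.one⟩
  have : IsOrderedRing hP.subfield := .of_mul_nonneg fun x y hx hy => by
    rw [hle] at hx hy ⊢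
    simpa using hP.mul (by simpa using hx) (by simpa using hy)
  exact IsOrderedRing.toIsStrictOrderedRing _

end IsSubfieldCone

open Polynomial in
/-- The intermediate value property for polynomials over an ordered field. -/
def PolynomialIVT (F : Type*) [Field F] [LinearOrder F] : Prop :=
  ∀ (f : F[X]) (a b : F), a ≤ b → f.eval a * f.eval b ≤ 0 →
    ∃ c, a ≤ c ∧ c ≤ b ∧ f.eval c = 0

section SignChange

open Polynomial

variable {F : Type*} [Field F] [LinearOrder F] [IsStrictOrderedRing F]

theorem exists_irreducible_dvd_of_eval_mul_neg {a b : F} (f : F[X])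
    (hf : f.eval a * f.eval b < 0) :
    ∃ g, Irreducible g ∧ g ∣ f ∧ g.eval a * g.eval b < 0 := by
  induction f using WfDvdMonoid.induction_on_irreducible with
  | zero => simp at hf
  | unit u hu =>
    obtain ⟨c, -, rfl⟩ := Polynomial.isUnit_iff.1 hu
    simp only [eval_C] at hf
    exact absurd hf (not_lt.2 (mul_self_nonneg c))
  | mul h i _ hi ih =>
    by_cases hneg : i.eval a * i.eval b < 0
    · exact ⟨i, hi, dvd_mul_right i h, hneg⟩
    · have hh : h.eval a * h.eval b < 0 := by
        by_contra hh
        have := mul_nonneg (not_lt.1 hneg) (not_lt.1 hh)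
        simp only [eval_mul] at hf
        nlinarith
      obtain ⟨g, hg, hgh, hgs⟩ := ih hh
      exact ⟨g, hg, hgh.mul_left i, hgs⟩

variable (F) in
/-- Sums of squares of polynomials with nonnegative weights. -/
noncomputable def weightedSumSq : AddSubmonoid F[X] :=
  AddSubmonoid.closure {s | ∃ p : F, 0 ≤ p ∧ ∃ g : F[X], s = C p * (g * g)}

theorem weightedSumSq_mul {s t : F[X]} (hs : s ∈ weightedSumSq F) (ht : t ∈ weightedSumSq F) :
    s * t ∈ weightedSumSq F := by
  induction hs using AddSubmonoid.closure_induction with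
  | zero => simp [zero_mem]
  | add x y _ _ hx hy => rw [add_mul]; exact add_mem hx hy
  | mem x hx =>
    obtain ⟨p, hp, g, rfl⟩ := hx
    induction ht using AddSubmonoid.closure_induction with
    | zero => simp [zero_mem]
    | add x y _ _ hx hy => rw [mul_add]; exact add_mem hx hy
    | mem x hx =>
      obtain ⟨q, hq, h, rfl⟩ := hx
      exact AddSubmonoid.subset_closure
        ⟨p * q, mul_nonneg hp hq, g * h, by rw [C_mul]; ring⟩

theorem exists_reduced_weightedSumSq {f s : F[X]} (hf : f.natDegree ≠ 0)
    (hs : s ∈ weightedSumSq F) :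
    ∃ t ∈ weightedSumSq F, t.natDegree ≤ 2 * (f.natDegree - 1) ∧ (∀ x, 0 ≤ t.eval x) ∧
      f ∣ s - t := by
  induction hs using AddSubmonoid.closure_induction with
  | zero => exact ⟨0, zero_mem _, by simp, by simp, by simp⟩
  | add x y _ _ hx hy =>
    obtain ⟨t, ht, htd, hte, hft⟩ := hx
    obtain ⟨u, hu, hud, hue, hfu⟩ := hy
    refine ⟨t + u, add_mem ht hu, natDegree_add_le_of_degree_le htd hud, fun x => ?_, ?_⟩
    · rw [eval_add]; exact add_nonneg (hte x) (hue x)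
    · have : x + y - (t + u) = (x - t) + (y - u) := by ring
      rw [this]
      exact dvd_add hft hfu
  | mem x hx =>
    obtain ⟨p, hp, g, rfl⟩ := hx
    refine ⟨C p * ((g % f) * (g % f)), AddSubmonoid.subset_closure ⟨p, hp, _, rfl⟩, ?_, ?_, ?_⟩
    · have h1 := natDegree_mod_lt g hf
      have h2 : (g % f * (g % f)).natDegree ≤ _ := natDegree_mul_le
      have h3 := natDegree_C_mul_le p (g % f * (g % f))
      omega
    · intro x
      simp only [eval_mul, eval_C]
      exact mul_nonneg hp (mul_self_nonneg _)
    · have h : f ∣ g - g % f := ⟨g / f, by linear_combination -(EuclideanDomain.div_add_mod g f)⟩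
      have : C p * (g * g) - C p * ((g % f) * (g % f))
          = (g - g % f) * (C p * (g + g % f)) := by ring
      rw [this]
      exact h.mul_right _

theorem not_dvd_weightedSumSq_add_one {a b : F} {f : F[X]} (hf : Irreducible f)
    (hab : f.eval a * f.eval b < 0) {s : F[X]} (hs : s ∈ weightedSumSq F) : ¬ f ∣ s + 1 := by
  induction hn : f.natDegree using Nat.strong_induction_on generalizing f s with
  | _ n ih =>
  intro hdvd
  have hpos := hf.natDegree_pos
  obtain ⟨t, ht, htd, hte, hft⟩ := exists_reduced_weightedSumSq hpos.ne' hs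
  have hdvd' : f ∣ t + 1 := by
    have : t + 1 = (s + 1) - (s - t) := by ring
    rw [this]
    exact dvd_sub hdvd hft
  obtain ⟨h, hh⟩ := hdvd'
  have hev : ∀ x, 0 < f.eval x * h.eval x := fun x => by
    rw [← eval_mul, ← hh, eval_add, eval_one]
    linarith [hte x]
  have hneg : h.eval a * h.eval b < 0 := by
    by_contra hcon
    have h1 := mul_pos (hev a) (hev b)
    have h2 := mul_nonneg (not_lt.1 hcon) (neg_nonneg.2 hab.le)
    nlinarith
  have hh0 : h ≠ 0 := by rintro rfl; simp at hneg
  obtain ⟨g, hg, hgh, hgs⟩ := exists_irreducible_dvd_of_eval_mul_neg h hneg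
  have hdeg : g.natDegree < n := by
    have h1 : (f * h).natDegree = f.natDegree + h.natDegree := natDegree_mul hf.ne_zero hh0
    have h2 : (t + 1).natDegree ≤ 2 * (f.natDegree - 1) :=
      natDegree_add_le_of_degree_le htd (by simp)
    have h3 := natDegree_le_of_dvd hgh hh0
    rw [hh] at h2
    omega
  exact ih _ hdeg hg hgs ht rfl (hh ▸ hgh.mul_left f)

theorem isFieldPreordering_adjoinRoot {a b : F} {f : F[X]} [hf : Fact (Irreducible f)]
    (hab : f.eval a * f.eval b < 0) :
    IsFieldPreordering (AdjoinRoot.mk f '' (weightedSumSq F : Set F[X])) where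
  add := by
    rintro _ _ ⟨x, hx, rfl⟩ ⟨y, hy, rfl⟩
    exact ⟨x + y, add_mem hx hy, map_add _ _ _⟩
  mul := by
    rintro _ _ ⟨x, hx, rfl⟩ ⟨y, hy, rfl⟩
    exact ⟨x * y, weightedSumSq_mul hx hy, map_mul _ _ _⟩
  mul_self := by
    intro x
    obtain ⟨g, rfl⟩ := AdjoinRoot.mk_surjective x
    exact ⟨g * g, AddSubmonoid.subset_closure ⟨1, zero_le_one, g, by simp⟩, map_mul _ _ _⟩
  neg_one := by
    rintro ⟨s, hs, h⟩
    refine not_dvd_weightedSumSq_add_one hf.out hab hs ?_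
    rw [← AdjoinRoot.mk_eq_zero, map_add, map_one, h, neg_add_cancel]

end SignChange

section RealClosure

universe u

open Polynomial

theorem IsSubfieldCone.exists_maximal {Ω : Type*} [Field Ω] {P₀ : Set Ω}
    (h₀ : IsSubfieldCone P₀) : ∃ P, P₀ ⊆ P ∧ Maximal (· ∈ {P : Set Ω | IsSubfieldCone P}) P := by
  refine zorn_subset_nonempty {P : Set Ω | IsSubfieldCone P} ?_ P₀ h₀
  intro c hc hchain ⟨s₀, hs₀⟩
  refine ⟨⋃₀ c, ⟨?_, ?_, ?_, ?_, ?_, ?_⟩, fun s hs => Set.subset_sUnion_of_mem hs⟩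
  · exact ⟨s₀, hs₀, (hc hs₀).one⟩
  · rintro x y ⟨s, hs, hx⟩ ⟨t, ht, hy⟩
    obtain ⟨u, hu, hsu, htu⟩ := hchain.directedOn s hs t ht
    exact ⟨u, hu, (hc hu).add (hsu hx) (htu hy)⟩
  · rintro x y ⟨s, hs, hx⟩ ⟨t, ht, hy⟩
    obtain ⟨u, hu, hsu, htu⟩ := hchain.directedOn s hs t ht
    exact ⟨u, hu, (hc hu).mul (hsu hx) (htu hy)⟩
  · rintro x ⟨s, hs, hx⟩
    exact ⟨s, hs, (hc hs).inv hx⟩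
  · rintro x y ⟨s, hs, hx⟩ ⟨t, ht, hy⟩
    obtain ⟨u, hu, hsu, htu⟩ := hchain.directedOn s hs t ht
    exact ((hc hu).sub (hsu hx) (htu hy)).imp (fun h => ⟨u, hu, h⟩) (fun h => ⟨u, hu, h⟩)
  · rintro ⟨s, hs, h⟩
    exact (hc hs).neg_one h

theorem IsSubfieldCone.polynomialIVT_of_maximal {Ω : Type*} [Field Ω] [IsAlgClosed Ω] {P : Set Ω}
    (hP : IsSubfieldCone P) (hmax : Maximal (· ∈ {P : Set Ω | IsSubfieldCone P}) P) :
    let _ := hP.linearOrder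
    PolynomialIVT hP.subfield := by
  intro _ f a b hab hfab
  have := hP.isStrictOrderedRing
  rcases hfab.lt_or_eq with hlt | heq
  · obtain ⟨g, hg, ⟨k, rfl⟩, hgab⟩ := exists_irreducible_dvd_of_eval_mul_neg f hlt
    have : Fact (Irreducible g) := ⟨hg⟩
    obtain ⟨Q, hTQ, hQ, hQtot⟩ := (isFieldPreordering_adjoinRoot hgab).exists_total
    obtain ⟨α, hα⟩ := IsAlgClosed.exists_eval₂_eq_zero hP.subfield.subtype g
      (fun h => hg.natDegree_pos.ne' (natDegree_eq_of_degree_eq_some h))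
    let ι : AdjoinRoot g →+* Ω := AdjoinRoot.lift hP.subfield.subtype α hα
    have hcone := (hQ.isSubfieldCone hQtot).image ι
    have hPQ : P ⊆ ι '' Q := by
      intro x hx
      refine ⟨AdjoinRoot.of g ⟨x, Or.inl hx⟩, hTQ ⟨C ⟨x, Or.inl hx⟩, ?_, rfl⟩, ?_⟩
      · refine AddSubmonoid.subset_closure ⟨⟨x, Or.inl hx⟩, ?_, 1, by simp⟩
        change x - 0 ∈ P
        simpa using hx
      · exact AdjoinRoot.lift_of hα
    have hQP : ι '' Q ⊆ P := hmax.le_of_ge hcone hPQ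
    have hιroot : ι (AdjoinRoot.root g) = α := AdjoinRoot.lift_root hα
    have hαP : α ∈ hP.subfield := by
      rcases hQtot (AdjoinRoot.root g) with h | h
      · exact Or.inl (hQP ⟨_, h, hιroot⟩)
      · exact Or.inr (hQP ⟨_, h, by rw [map_neg, hιroot]⟩)
    have hroot : g.IsRoot ⟨α, hαP⟩ := by
      apply Subtype.ext
      have h := hα
      rw [show α = hP.subfield.subtype ⟨α, hαP⟩ from rfl, eval₂_at_apply] at h
      exact h
    obtain ⟨u, hu⟩ := dvd_iff_isRoot.2 hroot
    have hunit : IsUnit u := (hg.isUnit_or_isUnit hu).resolve_left (not_isUnit_X_sub_C _)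
    obtain ⟨c, -, rfl⟩ := Polynomial.isUnit_iff.1 hunit
    refine ⟨⟨α, hαP⟩, ?_, ?_, ?_⟩
    · by_contra hcon
      rw [hu] at hgab
      simp only [eval_mul, eval_sub, eval_X, eval_C] at hgab
      nlinarith [mul_pos (sub_pos.2 (not_le.1 hcon)) (sub_pos.2 ((not_le.1 hcon).trans_le hab)),
        mul_self_nonneg c]
    · by_contra hcon
      rw [hu] at hgab
      simp only [eval_mul, eval_sub, eval_X, eval_C] at hgab
      nlinarith [mul_pos (sub_pos.2 (not_le.1 hcon)) (sub_pos.2 (hab.trans_lt (not_le.1 hcon))),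
        mul_self_nonneg c]
    · rw [eval_mul, hroot.eq_zero, zero_mul]
  · rcases mul_eq_zero.1 heq with h | h
    · exact ⟨a, le_rfl, hab, h⟩
    · exact ⟨b, hab, le_rfl, h⟩

/-- A field in which `-1` is not a sum of squares embeds in an ordered field with the
intermediate value property. -/
theorem exists_ringHom_polynomialIVT {K : Type u} [Field K] (hK : ¬ IsSumSq (-1 : K)) :
    ∃ (E : Type u) (_ : Field E) (_ : LinearOrder E) (_ : IsStrictOrderedRing E),
      PolynomialIVT E ∧ Nonempty (K →+* E) := by
  have hT : IsFieldPreordering {x : K | IsSumSq x} :=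
    ⟨fun hx hy => hx.add hy, fun hx hy => hx.mul hy, fun x => .mul_self x, hK⟩
  obtain ⟨P₀, -, hP₀, htot⟩ := hT.exists_total
  let ι := algebraMap K (AlgebraicClosure K)
  obtain ⟨P, h₀P, hmax⟩ := ((hP₀.isSubfieldCone htot).image ι).exists_maximal
  have hP : IsSubfieldCone P := hmax.prop
  have hι : ∀ x, ι x ∈ hP.subfield := fun x => (htot x).imp
    (fun h => h₀P ⟨x, h, rfl⟩) (fun h => h₀P ⟨-x, h, map_neg _ _⟩)
  exact ⟨hP.subfield, inferInstance, hP.linearOrder, hP.isStrictOrderedRing,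
    hP.polynomialIVT_of_maximal hmax, ⟨ι.codRestrict hP.subfield hι⟩⟩

end RealClosure

section IntermediateValue

open Polynomial

variable {F : Type*} [Field F] [LinearOrder F] [IsStrictOrderedRing F]

theorem PolynomialIVT.sign_eval_eq (hF : PolynomialIVT F) {f : F[X]} {a b : F} (hab : a ≤ b)
    (h : ∀ c, a ≤ c → c ≤ b → f.eval c ≠ 0) :
    SignType.sign (f.eval a) = SignType.sign (f.eval b) := by
  have hpos : 0 < f.eval a * f.eval b := by
    by_contra hcon
    obtain ⟨c, hac, hcb, hc⟩ := hF f a b hab (not_lt.1 hcon)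
    exact h c hac hcb hc
  rcases mul_pos_iff.1 hpos with ⟨h1, h2⟩ | ⟨h1, h2⟩
  · rw [sign_pos h1, sign_pos h2]
  · rw [sign_neg h1, sign_neg h2]

theorem PolynomialIVT.eval_pos (hF : PolynomialIVT F) {f : F[X]} {a b m x : F}
    (h : ∀ c, a < c → c < b → f.eval c ≠ 0) (ham : a < m) (hmb : m < b) (hm : 0 < f.eval m)
    (hax : a < x) (hxb : x < b) : 0 < f.eval x := by
  rw [← sign_eq_one_iff, ← sign_eq_one_iff.2 hm]
  rcases le_total x m with hxm | hxm
  · exact hF.sign_eval_eq hxm fun c h1 h2 => h c (hax.trans_le h1) (h2.trans_lt hmb)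
  · exact (hF.sign_eval_eq hxm fun c h1 h2 => h c (ham.trans_le h1) (h2.trans_lt hxb)).symm

theorem PolynomialIVT.eval_lt_eval (hF : PolynomialIVT F) {f : F[X]} {a b : F} (hab : a < b)
    (h : ∀ c, a ≤ c → c ≤ b → 0 < (derivative f).eval c) : f.eval a < f.eval b := by
  by_contra hcon
  obtain ⟨q, hq⟩ : X - C a ∣ f - C (f.eval a) := by
    rw [dvd_iff_isRoot]; simp
  have hfe : ∀ x, f.eval x - f.eval a = (x - a) * q.eval x := fun x => by
    simpa using congrArg (eval x) hq
  have hfd : ∀ x, (derivative f).eval x = q.eval x + (x - a) * (derivative q).eval x := fun x => by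
    simpa using congrArg (fun p => (derivative p).eval x) hq
  have hqa : 0 < q.eval a := by simpa [hfd] using h a le_rfl hab.le
  have hqb : q.eval b ≤ 0 := by
    have := hfe b
    by_contra hc
    nlinarith [mul_pos (sub_pos.2 hab) (not_le.1 hc)]
  have hq0 : q ≠ 0 := by rintro rfl; simp at hqa
  obtain ⟨c, hc, hcmin⟩ : ∃ c ∈ q.roots.toFinset.filter (fun x => a ≤ x ∧ x ≤ b),
      ∀ d ∈ q.roots.toFinset.filter (fun x => a ≤ x ∧ x ≤ b), c ≤ d := by
    apply Finset.exists_min_image _ id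
    obtain ⟨c, hac, hcb, hc⟩ := hF q a b hab.le (mul_nonpos_of_nonneg_of_nonpos hqa.le hqb)
    exact ⟨c, by simp [hq0, hac, hcb, hc]⟩
  simp only [Finset.mem_filter, Multiset.mem_toFinset, mem_roots hq0, IsRoot.def] at hc hcmin
  obtain ⟨hqc, hac, hcb⟩ := hc
  have hac' : a < c := hac.lt_of_ne (by rintro rfl; exact hqa.ne' hqc)
  obtain ⟨r, rfl⟩ := dvd_iff_isRoot.2 (show q.IsRoot c from hqc)
  have hrc : 0 < r.eval c := by
    have := h c hac hcb
    rw [hfd] at this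
    simp only [eval_mul, eval_sub, eval_X, eval_C, sub_self, zero_mul, derivative_mul,
      derivative_sub, derivative_X, derivative_C, sub_zero, one_mul, eval_add, add_zero,
      zero_add] at this
    exact pos_of_mul_pos_right this (sub_nonneg.2 hac)
  have hra : r.eval a ≤ 0 := by
    simp only [eval_mul, eval_sub, eval_X, eval_C] at hqa
    by_contra hc
    nlinarith [mul_pos (sub_pos.2 hac') (not_le.1 hc)]
  obtain ⟨d, had, hdc, hd⟩ := hF r a c hac (mul_nonpos_of_nonpos_of_nonneg hra hrc.le)
  have := hcmin d ⟨by simp [hd], had, hdc.trans hcb⟩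
  exact hrc.ne' (le_antisymm this hdc ▸ hd)

theorem PolynomialIVT.sign_eval_eq_sign_sub (hF : PolynomialIVT F) {f : F[X]} {a b α x : F}
    (h : ∀ c, a < c → c < b → 0 < (derivative f).eval c) (haα : a < α) (hαb : α < b)
    (hα : f.eval α = 0) (hax : a < x) (hxb : x < b) :
    SignType.sign (f.eval x) = SignType.sign (x - α) := by
  rcases lt_trichotomy x α with hx | rfl | hx
  · rw [sign_neg (sub_neg.2 hx), sign_neg]
    rw [← hα]
    exact hF.eval_lt_eval hx fun c h1 h2 => h c (hax.trans_le h1) (h2.trans_lt hαb)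
  · simp [hα]
  · rw [sign_pos (sub_pos.2 hx), sign_pos]
    rw [← hα]
    exact hF.eval_lt_eval hx fun c h1 h2 => h c (haα.trans_le h1) (h2.trans_lt hxb)

theorem PolynomialIVT.eval_left_nonpos (hF : PolynomialIVT F) {f : F[X]} {a b α : F}
    (h : ∀ c, a < c → c < b → 0 < (derivative f).eval c) (haα : a < α) (hαb : α < b)
    (hα : f.eval α = 0) : f.eval a ≤ 0 := by
  by_contra hcon
  obtain ⟨x, hax, hxα⟩ := exists_between haα
  have hx : f.eval x < 0 := by
    rw [← sign_eq_neg_one_iff, hF.sign_eval_eq_sign_sub h haα hαb hα hax (hxα.trans hαb),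
      sign_neg (sub_neg.2 hxα)]
  obtain ⟨β, haβ, hβx, hβ⟩ := hF f a x hax.le
    (mul_nonpos_of_nonneg_of_nonpos (not_le.1 hcon).le hx.le)
  have haβ' : a < β := haβ.lt_of_ne (by rintro rfl; exact hcon hβ.le)
  have := hF.sign_eval_eq_sign_sub h haα hαb hα haβ' (hβx.trans_lt (hxα.trans hαb))
  rw [hβ, sign_zero, eq_comm, sign_eq_zero_iff, sub_eq_zero] at this
  exact (hβx.trans_lt hxα).ne this

theorem PolynomialIVT.eval_right_nonneg (hF : PolynomialIVT F) {f : F[X]} {a b α : F}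
    (h : ∀ c, a < c → c < b → 0 < (derivative f).eval c) (haα : a < α) (hαb : α < b)
    (hα : f.eval α = 0) : 0 ≤ f.eval b := by
  by_contra hcon
  obtain ⟨x, hαx, hxb⟩ := exists_between hαb
  have hx : 0 < f.eval x := by
    rw [← sign_eq_one_iff, hF.sign_eval_eq_sign_sub h haα hαb hα (haα.trans hαx) hxb,
      sign_pos (sub_pos.2 hαx)]
  obtain ⟨β, hxβ, hβb, hβ⟩ := hF f x b hxb.le
    (mul_nonpos_of_nonneg_of_nonpos hx.le (not_le.1 hcon).le)
  have hβb' : β < b := hβb.lt_of_ne (by rintro rfl; exact hcon hβ.ge)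
  have := hF.sign_eval_eq_sign_sub h haα hαb hα (haα.trans (hαx.trans_le hxβ)) hβb'
  rw [hβ, sign_zero, eq_comm, sign_eq_zero_iff, sub_eq_zero] at this
  exact (hαx.trans_le hxβ).ne' this

theorem exists_abs_le_of_isRoot {L : Type*} [Field L] (φ : L →+* F) {f : L[X]} (hf : f ≠ 0)
    {α : F} (hα : (f.map φ).eval α = 0) : ∃ B, |α| ≤ φ B := by
  let c : ℕ → L := fun i => f.coeff i / f.leadingCoeff
  refine ⟨1 + ∑ i ∈ Finset.range f.natDegree, (1 + c i ^ 2), ?_⟩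
  have hsum : (0 : F) ≤ ∑ i ∈ Finset.range f.natDegree, (1 + φ (c i) ^ 2) :=
    Finset.sum_nonneg fun i _ => by positivity
  simp only [map_add, map_one, map_sum, map_pow]
  by_contra hcon
  have hα1 : 1 < |α| := by linarith
  have hlc : φ f.leadingCoeff ≠ 0 := by simpa using hf
  have hpow : α ^ f.natDegree = -∑ i ∈ Finset.range f.natDegree, φ (c i) * α ^ i := by
    rw [eval_map, eval₂_eq_sum_range, Finset.sum_range_succ] at hα
    apply mul_left_cancel₀ hlc
    rw [mul_neg, Finset.mul_sum]
    have : ∀ i ∈ Finset.range f.natDegree,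
        φ f.leadingCoeff * (φ (c i) * α ^ i) = φ (f.coeff i) * α ^ i := fun i _ => by
      simp only [c, map_div₀]
      field_simp
    rw [Finset.sum_congr rfl this]
    rw [coeff_natDegree] at hα
    linear_combination hα
  have hn : f.natDegree ≠ 0 := fun h0 => by
    rw [h0] at hpow
    simp at hpow
  have hle : |α| ^ f.natDegree ≤
      (∑ i ∈ Finset.range f.natDegree, (1 + φ (c i) ^ 2)) * |α| ^ (f.natDegree - 1) := by
    rw [← abs_pow, hpow, abs_neg, Finset.sum_mul]
    refine (Finset.abs_sum_le_sum_abs _ _).trans (Finset.sum_le_sum fun i hi => ?_)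
    rw [abs_mul, abs_pow]
    refine mul_le_mul ?_ ?_ (by positivity) (by positivity)
    · nlinarith [sq_abs (φ (c i)), sq_nonneg (|φ (c i)| - 1), abs_nonneg (φ (c i))]
    · exact pow_le_pow_right₀ hα1.le (by have := Finset.mem_range.1 hi; omega)
  have hsplit : |α| ^ f.natDegree = |α| * |α| ^ (f.natDegree - 1) := by
    rw [← pow_succ', Nat.sub_add_cancel (Nat.pos_of_ne_zero hn)]
  rw [hsplit] at hle
  have := le_of_mul_le_mul_right hle (by positivity)
  linarith

omit [IsStrictOrderedRing F] in
theorem exists_adjacent {L : Type*} [Field L] (φ : L →+* F) (S : Finset L) {α : F}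
    (hα : α ∉ φ.range) {a b : L} (ha : a ∈ S) (hb : b ∈ S) (haα : φ a < α) (hαb : α < φ b) :
    ∃ u v, φ u < α ∧ α < φ v ∧ ∀ s ∈ S, φ s ≤ φ u ∨ φ v ≤ φ s := by
  obtain ⟨u, hu, humax⟩ := Finset.exists_max_image (S.filter fun s => φ s < α) φ
    ⟨a, by simp [ha, haα]⟩
  obtain ⟨v, hv, hvmin⟩ := Finset.exists_min_image (S.filter fun s => α < φ s) φ
    ⟨b, by simp [hb, hαb]⟩
  simp only [Finset.mem_filter] at hu hv humax hvmin
  refine ⟨u, v, hu.2, hv.2, fun s hs => ?_⟩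
  rcases lt_trichotomy (φ s) α with h | h | h
  · exact Or.inl (humax s ⟨hs, h⟩)
  · exact absurd ⟨s, h⟩ hα
  · exact Or.inr (hvmin s ⟨hs, h⟩)

end IntermediateValue

section TransferOfRoots

open Polynomial

variable {K R : Type*} [Field K] [LinearOrder K] [IsStrictOrderedRing K] [Field R] [LinearOrder R]
  [IsStrictOrderedRing R] {L : Type*} [Field L] {φ : L →+* K} {ψ : L →+* R}

theorem lt_iff_lt_of_sign_eq (hs : ∀ l, SignType.sign (φ l) = SignType.sign (ψ l)) (a b : L) :
    φ a < φ b ↔ ψ a < ψ b := by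
  rw [← sub_pos, ← map_sub, ← sub_pos (a := ψ b), ← map_sub, ← sign_eq_one_iff, hs,
    sign_eq_one_iff]

/-- Two elements with the same cut over `L` give the same sign to polynomials all of whose
roots lie in `L`. -/
theorem sign_eval_eq_of_same_cut (hK : PolynomialIVT K) (hR : PolynomialIVT R)
    (hs : ∀ l, SignType.sign (φ l) = SignType.sign (ψ l)) {n : ℕ}
    (hrK : ∀ g : L[X], g ≠ 0 → g.natDegree < n → ∀ x, (g.map φ).eval x = 0 → x ∈ φ.range)
    (hrR : ∀ g : L[X], g ≠ 0 → g.natDegree < n → ∀ x, (g.map ψ).eval x = 0 → x ∈ ψ.range)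
    {α : K} {β : R} (hcut : ∀ l, SignType.sign (α - φ l) = SignType.sign (β - ψ l))
    (g : L[X]) (hgn : g.natDegree < n) :
    SignType.sign ((g.map φ).eval α) = SignType.sign ((g.map ψ).eval β) := by
  induction hd : g.natDegree using Nat.strong_induction_on generalizing g with
  | _ d ih =>
  by_cases hg0 : g = 0
  · simp [hg0]
  by_cases hroot : ∃ l, g.eval l = 0
  · obtain ⟨l, hl⟩ := hroot
    obtain ⟨q, rfl⟩ := dvd_iff_isRoot.2 (show g.IsRoot l from hl)
    have hq0 : q ≠ 0 := right_ne_zero_of_mul hg0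
    have hdeg : ((X - C l) * q).natDegree = 1 + q.natDegree := by
      rw [natDegree_mul (X_sub_C_ne_zero l) hq0, natDegree_X_sub_C]
    have := ih q.natDegree (by omega) q (by omega) rfl
    simp only [Polynomial.map_mul, Polynomial.map_sub, map_X, map_C, eval_mul, eval_sub, eval_X,
      eval_C, sign_mul, hcut, this]
  · push Not at hroot
    have h1 : ∀ c, (g.map φ).eval c ≠ 0 := fun c hc => by
      obtain ⟨l, rfl⟩ := hrK g hg0 hgn c hc
      rw [eval_map_apply, map_eq_zero] at hc
      exact hroot l hc
    have h2 : ∀ c, (g.map ψ).eval c ≠ 0 := fun c hc => by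
      obtain ⟨l, rfl⟩ := hrR g hg0 hgn c hc
      rw [eval_map_apply, map_eq_zero] at hc
      exact hroot l hc
    have h3 : SignType.sign ((g.map φ).eval α) = SignType.sign ((g.map φ).eval (φ 0)) := by
      rcases le_total α (φ 0) with h | h
      · exact hK.sign_eval_eq h fun c _ _ => h1 c
      · exact (hK.sign_eval_eq h fun c _ _ => h1 c).symm
    have h4 : SignType.sign ((g.map ψ).eval β) = SignType.sign ((g.map ψ).eval (ψ 0)) := by
      rcases le_total β (ψ 0) with h | h
      · exact hR.sign_eval_eq h fun c _ _ => h2 c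
      · exact (hR.sign_eval_eq h fun c _ _ => h2 c).symm
    rw [h3, h4, eval_map_apply, eval_map_apply, hs]

/-- A root in `K` of a polynomial over `L` of minimal degree among those having roots outside
`L` has a counterpart in `R`. -/
theorem exists_sign_eval_eq_of_minimal (hK : PolynomialIVT K) (hR : PolynomialIVT R)
    (hs : ∀ l, SignType.sign (φ l) = SignType.sign (ψ l)) {f : L[X]} (hf : f ≠ 0)
    (hrK : ∀ g : L[X], g ≠ 0 → g.natDegree < f.natDegree →
      ∀ x, (g.map φ).eval x = 0 → x ∈ φ.range)
    (hrR : ∀ g : L[X], g ≠ 0 → g.natDegree < f.natDegree →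
      ∀ x, (g.map ψ).eval x = 0 → x ∈ ψ.range)
    {α : K} (hα : (f.map φ).eval α = 0) (hαL : α ∉ φ.range) :
    ∃ β : R, ∀ g : L[X],
      SignType.sign ((g.map φ).eval α) = SignType.sign ((g.map ψ).eval β) := by
  have : CharZero L := φ.charZero
  have hlt := lt_iff_lt_of_sign_eq hs
  have hdeg : f.natDegree ≠ 0 := fun h0 => by
    obtain ⟨c, rfl⟩ := natDegree_eq_zero.1 h0
    simp only [map_C, eval_C, map_eq_zero] at hα
    exact hf (by simp [hα])
  have hd0 : derivative f ≠ 0 := fun h => hdeg (derivative_eq_zero.1 h)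
  have hdlt : (derivative f).natDegree < f.natDegree := natDegree_derivative_lt hdeg
  have hroot : ∀ l, f.eval l ≠ 0 := fun l hl => by
    obtain ⟨q, rfl⟩ := dvd_iff_isRoot.2 (show f.IsRoot l from hl)
    have hq0 : q ≠ 0 := right_ne_zero_of_mul hf
    simp only [Polynomial.map_mul, Polynomial.map_sub, map_X, map_C, eval_mul, eval_sub, eval_X,
      eval_C, mul_eq_zero, sub_eq_zero] at hα
    rcases hα with h | h
    · exact hαL ⟨l, h.symm⟩
    · refine hαL (hrK q hq0 ?_ α h)
      rw [natDegree_mul (X_sub_C_ne_zero l) hq0, natDegree_X_sub_C]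
      omega
  obtain ⟨B, hB⟩ := exists_abs_le_of_isRoot φ hf hα
  obtain ⟨hB1, hB2⟩ := abs_le.1 hB
  classical
  obtain ⟨u, v, huα, hαv, huv⟩ := exists_adjacent φ
    ((derivative f).roots.toFinset ∪ {-B, B}) hαL (a := -B) (b := B) (by simp) (by simp)
    (lt_of_le_of_ne (by simpa using hB1) fun h => hαL ⟨-B, h⟩)
    (lt_of_le_of_ne hB2 fun h => hαL ⟨B, h.symm⟩)
  have hderK : ∀ c, φ u < c → c < φ v → ((derivative f).map φ).eval c ≠ 0 := by
    intro c huc hcv hc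
    obtain ⟨l, rfl⟩ := hrK _ hd0 hdlt c hc
    rw [eval_map_apply, map_eq_zero] at hc
    rcases huv l (by simp [hd0, hc]) with h | h
    · exact h.not_gt huc
    · exact h.not_gt hcv
  have hderR : ∀ c, ψ u < c → c < ψ v → ((derivative f).map ψ).eval c ≠ 0 := by
    intro c huc hcv hc
    obtain ⟨l, rfl⟩ := hrR _ hd0 hdlt c hc
    rw [eval_map_apply, map_eq_zero] at hc
    rcases huv l (by simp [hd0, hc]) with h | h
    · exact h.not_gt ((hlt _ _).2 huc)
    · exact h.not_gt ((hlt _ _).2 hcv)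
  obtain ⟨m, hum, hmv⟩ : ∃ m, φ u < φ m ∧ φ m < φ v := by
    refine ⟨(u + v) / 2, ?_, ?_⟩ <;> simp only [map_div₀, map_add, map_ofNat] <;>
      linarith [huα.trans hαv]
  -- normalise the sign of the derivative
  obtain ⟨p, hpdeg, hpα, hproot, hpm, hpK, hpR⟩ : ∃ p : L[X], p.natDegree = f.natDegree ∧
      (p.map φ).eval α = 0 ∧ (∀ l, p.eval l ≠ 0) ∧ 0 < φ ((derivative p).eval m) ∧
      (∀ c, φ u < c → c < φ v → ((derivative p).map φ).eval c ≠ 0) ∧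
      (∀ c, ψ u < c → c < ψ v → ((derivative p).map ψ).eval c ≠ 0) := by
    have hm0 := hderK (φ m) hum hmv
    rw [eval_map_apply] at hm0
    rcases hm0.lt_or_gt with h | h
    · exact ⟨-f, by simp, by simpa using hα, by simpa using hroot, by simpa using h,
        by simpa using hderK, by simpa using hderR⟩
    · exact ⟨f, rfl, hα, hroot, h, hderK, hderR⟩
  have hp0 : p ≠ 0 := by rintro rfl; exact hproot 0 (by simp)
  have hposK : ∀ c, φ u < c → c < φ v → 0 < (derivative (p.map φ)).eval c := by
    rw [derivative_map]
    exact fun c h1 h2 => hK.eval_pos hpK hum hmv (by rwa [eval_map_apply]) h1 h2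
  have hposR : ∀ c, ψ u < c → c < ψ v → 0 < (derivative (p.map ψ)).eval c := by
    rw [derivative_map]
    refine fun c h1 h2 => hR.eval_pos hpR ((hlt _ _).1 hum) ((hlt _ _).1 hmv) ?_ h1 h2
    rwa [eval_map_apply, ← sign_eq_one_iff, ← hs, sign_eq_one_iff]
  have hpu : φ (p.eval u) < φ 0 := by
    have := hK.eval_left_nonpos hposK huα hαv hpα
    rw [eval_map_apply] at this
    rw [map_zero]
    exact this.lt_of_ne (by simpa using hproot u)
  have hpv : φ 0 < φ (p.eval v) := by
    have := hK.eval_right_nonneg hposK huα hαv hpα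
    rw [eval_map_apply] at this
    rw [map_zero]
    exact this.lt_of_ne' (by simpa using hproot v)
  rw [hlt, map_zero] at hpu hpv
  obtain ⟨β, huβ, hβv, hβ⟩ := hR (p.map ψ) (ψ u) (ψ v) ((hlt _ _).1 (hum.trans hmv)).le
    (by rw [eval_map_apply, eval_map_apply]
        exact mul_nonpos_of_nonpos_of_nonneg hpu.le hpv.le)
  have huβ' : ψ u < β := huβ.lt_of_ne (by
    rintro rfl
    rw [eval_map_apply] at hβ
    exact hpu.ne hβ)
  have hβv' : β < ψ v := hβv.lt_of_ne (by
    rintro rfl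
    rw [eval_map_apply] at hβ
    exact hpv.ne' hβ)
  have hcut : ∀ l, SignType.sign (α - φ l) = SignType.sign (β - ψ l) := by
    intro l
    rcases le_or_gt (φ l) (φ u) with h | hul
    · have h' : ψ l ≤ ψ u := by rwa [← not_lt, ← hlt, not_lt]
      rw [sign_pos (sub_pos.2 (h.trans_lt huα)), sign_pos (sub_pos.2 (h'.trans_lt huβ'))]
    rcases le_or_gt (φ v) (φ l) with h | hlv
    · have h' : ψ v ≤ ψ l := by rwa [← not_lt, ← hlt, not_lt]
      rw [sign_neg (sub_neg.2 (hαv.trans_le h)), sign_neg (sub_neg.2 (hβv'.trans_le h'))]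
    have h1 := hK.sign_eval_eq_sign_sub hposK huα hαv hpα hul hlv
    have h2 := hR.sign_eval_eq_sign_sub hposR huβ' hβv' hβ ((hlt _ _).1 hul) ((hlt _ _).1 hlv)
    rw [eval_map_apply] at h1 h2
    rw [← neg_sub, ← neg_sub (ψ l), Left.sign_neg, Left.sign_neg, ← h1, ← h2, hs]
  refine ⟨β, fun g => ?_⟩
  have hmod := sign_eval_eq_of_same_cut hK hR hs hrK hrR hcut (g % p)
    (by rw [← hpdeg]; exact natDegree_mod_lt g (hpdeg ▸ hdeg))
  have hK' : (g.map φ).eval α = ((g % p).map φ).eval α := by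
    conv_lhs => rw [← EuclideanDomain.div_add_mod g p]
    simp [hpα]
  have hR' : (g.map ψ).eval β = ((g % p).map ψ).eval β := by
    conv_lhs => rw [← EuclideanDomain.div_add_mod g p]
    simp [hβ]
  rw [hK', hR', hmod]

end TransferOfRoots

section Amalgamation

open Polynomial

universe u v

variable {K : Type u} {R : Type v} [Field K] [LinearOrder K] [IsStrictOrderedRing K]
  [Field R] [LinearOrder R] [IsStrictOrderedRing R]

/-- A subring of `K × R` is sign compatible if both coordinates of each element have the same
sign, i.e. if it is the graph of an order isomorphism between subrings of `K` and `R`. -/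
def SignCompatible (G : Subring (K × R)) : Prop :=
  ∀ z ∈ G, SignType.sign z.1 = SignType.sign z.2

omit [IsStrictOrderedRing K] [IsStrictOrderedRing R] in
theorem SignCompatible.exists_maximal {G₀ : Subring (K × R)} (h₀ : SignCompatible G₀) :
    ∃ G, G₀ ≤ G ∧ Maximal SignCompatible G := by
  refine zorn_le_nonempty₀ {G : Subring (K × R) | SignCompatible G} ?_ G₀ h₀
  intro c hc hchain y hy
  refine ⟨sSup c, fun z hz => ?_, fun G hG => le_sSup hG⟩
  obtain ⟨G, hG, hzG⟩ := (Subring.mem_sSup_of_directedOn ⟨y, hy⟩ hchain.directedOn).1 hz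
  exact hc hG z hzG

omit [IsStrictOrderedRing K] [IsStrictOrderedRing R] in
theorem SignCompatible.fst_eq_zero_iff {G : Subring (K × R)} (hG : SignCompatible G) {z : K × R}
    (hz : z ∈ G) : z.1 = 0 ↔ z.2 = 0 := by
  rw [← sign_eq_zero_iff, hG z hz, sign_eq_zero_iff]

theorem SignCompatible.isField_of_maximal {G : Subring (K × R)} (hG : Maximal SignCompatible G) :
    IsField G where
  exists_pair_ne := ⟨0, 1, zero_ne_one⟩
  mul_comm := mul_comm
  mul_inv_cancel := by
    rintro ⟨d, hd⟩ hd0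
    have hd1 : d.1 ≠ 0 := fun h => hd0 (Subtype.ext
      (Prod.ext h ((SignCompatible.fst_eq_zero_iff hG.prop hd).1 h)))
    have hd2 : d.2 ≠ 0 := fun h => hd1 ((SignCompatible.fst_eq_zero_iff hG.prop hd).2 h)
    let G' : Subring (K × R) :=
      { carrier := {z | ∃ n : ℕ, z * d ^ n ∈ G}
        zero_mem' := ⟨0, by simp [G.zero_mem]⟩
        one_mem' := ⟨0, by simp [G.one_mem]⟩
        neg_mem' := by
          rintro z ⟨n, hn⟩
          exact ⟨n, by simpa using hn⟩
        add_mem' := by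
          rintro z w ⟨n, hn⟩ ⟨m, hm⟩
          refine ⟨n + m, ?_⟩
          have : (z + w) * d ^ (n + m) = z * d ^ n * d ^ m + w * d ^ m * d ^ n := by ring
          rw [this]
          exact G.add_mem (G.mul_mem hn (G.pow_mem hd m)) (G.mul_mem hm (G.pow_mem hd n))
        mul_mem' := by
          rintro z w ⟨n, hn⟩ ⟨m, hm⟩
          refine ⟨n + m, ?_⟩
          have : z * w * d ^ (n + m) = (z * d ^ n) * (w * d ^ m) := by ring
          rw [this]
          exact G.mul_mem hn hm }
    have hG' : SignCompatible G' := by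
      rintro z ⟨n, hn⟩
      have h := hG.prop _ hn
      simp only [Prod.fst_mul, Prod.snd_mul, Prod.pow_fst, Prod.pow_snd, sign_mul, sign_pow,
        hG.prop d hd] at h
      exact mul_right_cancel₀ (pow_ne_zero n (by simpa using hd2)) h
    have hle : G' ≤ G := hG.le_of_ge hG' fun z hz => ⟨0, by simpa using hz⟩
    have hmem : (d.1⁻¹, d.2⁻¹) ∈ G := hle ⟨1, by
      have : (d.1⁻¹, d.2⁻¹) * d ^ 1 = 1 := Prod.ext (by simp [hd1]) (by simp [hd2])
      rw [this]
      exact G.one_mem⟩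
    exact ⟨⟨_, hmem⟩, Subtype.ext (Prod.ext (by simp [hd1]) (by simp [hd2]))⟩

omit [IsStrictOrderedRing K] [IsStrictOrderedRing R] in
theorem SignCompatible.mem_of_maximal {G : Subring (K × R)} (hG : Maximal SignCompatible G)
    (z : K × R) (h : ∀ g : G[X],
      SignType.sign ((g.map ((RingHom.fst K R).comp G.subtype)).eval z.1) =
        SignType.sign ((g.map ((RingHom.snd K R).comp G.subtype)).eval z.2)) : z ∈ G := by
  let e : G[X] →+* K × R := eval₂RingHom G.subtype z
  have he1 : ∀ g, (e g).1 = (g.map ((RingHom.fst K R).comp G.subtype)).eval z.1 := fun g => by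
    rw [eval_map]
    exact hom_eval₂ g G.subtype (RingHom.fst K R) z
  have he2 : ∀ g, (e g).2 = (g.map ((RingHom.snd K R).comp G.subtype)).eval z.2 := fun g => by
    rw [eval_map]
    exact hom_eval₂ g G.subtype (RingHom.snd K R) z
  have hle : e.range ≤ G := by
    refine hG.le_of_ge ?_ fun w hw => ⟨C ⟨w, hw⟩, by simp [e]⟩
    rintro _ ⟨g, rfl⟩
    rw [he1, he2, h]
  exact hle ⟨X, by simp [e]⟩

/-- Two sign-compatible homomorphisms into ordered fields with the intermediate value property
extend to a field that is algebraically closed in the first of them. -/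
theorem exists_field_algebraicallyClosedIn (hK : PolynomialIVT K) (hR : PolynomialIVT R)
    {A : Type*} [CommRing A] (φ : A →+* K) (ψ : A →+* R)
    (hs : ∀ a, SignType.sign (φ a) = SignType.sign (ψ a)) :
    ∃ (L : Type (max u v)) (_ : Field L) (ι : A →+* L) (φ' : L →+* K) (ψ' : L →+* R),
      φ'.comp ι = φ ∧ ψ'.comp ι = ψ ∧
      (∀ l, SignType.sign (φ' l) = SignType.sign (ψ' l)) ∧
      ∀ g : L[X], g ≠ 0 → ∀ x, (g.map φ').eval x = 0 → x ∈ φ'.range := by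
  obtain ⟨G, hG₀, hG⟩ := SignCompatible.exists_maximal (G₀ := (φ.prod ψ).range) (by
    rintro _ ⟨a, rfl⟩
    exact hs a)
  let _ : Field G := (SignCompatible.isField_of_maximal hG).toField
  let φ' : G →+* K := (RingHom.fst K R).comp G.subtype
  let ψ' : G →+* R := (RingHom.snd K R).comp G.subtype
  have hs' : ∀ l, SignType.sign (φ' l) = SignType.sign (ψ' l) := fun l => hG.prop l l.2
  have key : ∀ n : ℕ, ∀ g : G[X], g.natDegree = n → g ≠ 0 →
      (∀ x, (g.map φ').eval x = 0 → x ∈ φ'.range) ∧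
      (∀ x, (g.map ψ').eval x = 0 → x ∈ ψ'.range) := by
    intro n
    induction n using Nat.strong_induction_on with
    | _ n ih =>
    intro g hgn hg
    have hrK : ∀ p : G[X], p ≠ 0 → p.natDegree < g.natDegree →
        ∀ x, (p.map φ').eval x = 0 → x ∈ φ'.range := fun p hp hpn =>
      (ih _ (hgn ▸ hpn) p rfl hp).1
    have hrR : ∀ p : G[X], p ≠ 0 → p.natDegree < g.natDegree →
        ∀ x, (p.map ψ').eval x = 0 → x ∈ ψ'.range := fun p hp hpn =>
      (ih _ (hgn ▸ hpn) p rfl hp).2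
    constructor
    · intro x hx
      by_contra hxG
      obtain ⟨y, hy⟩ := exists_sign_eval_eq_of_minimal hK hR hs' hg hrK hrR hx hxG
      exact hxG ⟨⟨(x, y), SignCompatible.mem_of_maximal hG (x, y) hy⟩, rfl⟩
    · intro x hx
      by_contra hxG
      obtain ⟨y, hy⟩ := exists_sign_eval_eq_of_minimal hR hK (fun l => (hs' l).symm) hg hrR hrK
        hx hxG
      exact hxG ⟨⟨(y, x), SignCompatible.mem_of_maximal hG (y, x) fun p => (hy p).symm⟩, rfl⟩
  refine ⟨G, inferInstance, (φ.prod ψ).codRestrict G fun a => hG₀ ⟨a, rfl⟩, φ', ψ',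
    RingHom.ext fun a => rfl, RingHom.ext fun a => rfl, hs', fun g hg => (key _ g rfl hg).1⟩

/-- Finitely many sign conditions on a polynomial variable that are realised in `K` can also be
realised in `R`. -/
theorem exists_sign_eval_eq (hK : PolynomialIVT K) (hR : PolynomialIVT R)
    {A : Type*} [CommRing A] (φ : A →+* K) (ψ : A →+* R)
    (hs : ∀ a, SignType.sign (φ a) = SignType.sign (ψ a)) (c : K) (T : Finset A[X]) :
    ∃ c' : R, ∀ h ∈ T,
      SignType.sign ((h.map φ).eval c) = SignType.sign ((h.map ψ).eval c') := by
  classical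
  obtain ⟨L, _, ι, φ', ψ', rfl, rfl, hs', hL⟩ :=
    exists_field_algebraicallyClosedIn hK hR φ ψ hs
  suffices H : ∃ l : L, ∀ h ∈ T,
      SignType.sign (((h.map ι).map φ').eval c) =
        SignType.sign (((h.map ι).map φ').eval (φ' l)) by
    obtain ⟨l, hl⟩ := H
    refine ⟨ψ' l, fun h hh => ?_⟩
    rw [← Polynomial.map_map, ← Polynomial.map_map, hl h hh, eval_map_apply, eval_map_apply, hs']
  by_cases hc : c ∈ φ'.range
  · obtain ⟨l, rfl⟩ := hc
    exact ⟨l, fun _ _ => rfl⟩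
  let S : Finset L := T.biUnion fun h => (h.map ι).roots.toFinset
  have hS : ∀ h ∈ T, h.map ι ≠ 0 → ∀ x, ((h.map ι).map φ').eval x = 0 → ∃ s ∈ S, φ' s = x := by
    intro h hh h0 x hx
    obtain ⟨s, rfl⟩ := hL _ h0 x hx
    rw [eval_map_apply, map_eq_zero] at hx
    exact ⟨s, Finset.mem_biUnion.2 ⟨h, hh, by simp [h0, hx]⟩, rfl⟩
  obtain ⟨l, hl⟩ : ∃ l, ∀ s ∈ S, (φ' s < c ∧ φ' s < φ' l) ∨ (c < φ' s ∧ φ' l < φ' s) := by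
    have htri : ∀ s, φ' s < c ∨ c < φ' s := fun s => lt_or_gt_of_ne fun h => hc ⟨s, h⟩
    by_cases hlow : ∃ a ∈ S, φ' a < c
    · by_cases hup : ∃ b ∈ S, c < φ' b
      · obtain ⟨a, ha, hac⟩ := hlow
        obtain ⟨b, hb, hcb⟩ := hup
        obtain ⟨u, v, huc, hcv, huv⟩ := exists_adjacent φ' S hc ha hb hac hcb
        refine ⟨(u + v) / 2, fun s hs => ?_⟩
        simp only [map_div₀, map_add, map_ofNat]
        exact (huv s hs).imp (fun h => ⟨by linarith, by linarith⟩)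
          (fun h => ⟨by linarith, by linarith⟩)
      · push Not at hup
        obtain ⟨a, ha, hac⟩ := hlow
        obtain ⟨u, hu, hmax⟩ := Finset.exists_max_image S φ' ⟨a, ha⟩
        refine ⟨u + 1, fun s hs => Or.inl ⟨(htri s).resolve_right (hup s hs).not_gt, ?_⟩⟩
        rw [map_add, map_one]
        linarith [hmax s hs]
    · push Not at hlow
      rcases S.eq_empty_or_nonempty with hS0 | hne
      · exact ⟨0, by simp [hS0]⟩
      · obtain ⟨u, hu, hmin⟩ := Finset.exists_min_image S φ' hne
        refine ⟨u - 1, fun s hs => Or.inr ⟨(htri s).resolve_left (hlow s hs).not_gt, ?_⟩⟩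
        rw [map_sub, map_one]
        linarith [hmin s hs]
  refine ⟨l, fun h hh => ?_⟩
  by_cases h0 : h.map ι = 0
  · simp [h0]
  rcases le_total c (φ' l) with hcl | hcl
  · refine hK.sign_eval_eq hcl fun x h1 h2 hx => ?_
    obtain ⟨s, hs, rfl⟩ := hS h hh h0 x hx
    rcases hl s hs with h | h <;> linarith [h.1, h.2]
  · refine (hK.sign_eval_eq hcl fun x h1 h2 hx => ?_).symm
    obtain ⟨s, hs, rfl⟩ := hS h hh h0 x hx
    rcases hl s hs with h | h <;> linarith [h.1, h.2]

end Amalgamation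

section Transfer

open Polynomial

theorem Real.polynomialIVT : PolynomialIVT ℝ := by
  intro f a b hab h
  have hc : ContinuousOn (fun x => f.eval x) (Set.Icc a b) := f.continuous.continuousOn
  rcases mul_nonpos_iff.1 h with ⟨h1, h2⟩ | ⟨h1, h2⟩
  · obtain ⟨c, hc, hc0⟩ := intermediate_value_Icc' hab hc ⟨h2, h1⟩
    exact ⟨c, hc.1, hc.2, hc0⟩
  · obtain ⟨c, hc, hc0⟩ := intermediate_value_Icc hab hc ⟨h1, h2⟩
    exact ⟨c, hc.1, hc.2, hc0⟩

theorem eval_map_evalRingHom {ι R : Type*} [CommRing R] (f : (ι → R)[X]) (a : ι → R) (i : ι) :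
    (f.map (Pi.evalRingHom (fun _ => R) i)).eval (a i) = f.eval a i := by
  rw [eval_map]
  exact (hom_eval₂ f (RingHom.id _) (Pi.evalRingHom (fun _ => R) i) a).symm

theorem PolynomialIVT.germ {ι F : Type*} [Field F] [LinearOrder F] [IsStrictOrderedRing F]
    (hF : PolynomialIVT F) (U : Ultrafilter ι) :
    PolynomialIVT (Filter.Germ (U : Filter ι) F) := by
  intro f a b
  obtain ⟨f, rfl⟩ := map_surjective (Filter.Germ.coeRingHom (U : Filter ι))
    (fun g => Filter.Germ.inductionOn g fun g => ⟨g, rfl⟩) f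
  induction a, b using Filter.Germ.inductionOn₂ with
  | _ a b =>
  intro hab h
  have he : ∀ c : ι → F, (f.map (Filter.Germ.coeRingHom (U : Filter ι))).eval
      (c : Filter.Germ (U : Filter ι) F) = (f.eval c : ι → F) := fun c =>
    eval_map_apply (f := Filter.Germ.coeRingHom (U : Filter ι)) (p := f) c
  rw [he, he, ← Filter.Germ.coe_mul, ← Filter.Germ.coe_zero, Filter.Germ.coe_le] at h
  rw [Filter.Germ.coe_le] at hab
  have key : ∀ i, ∃ c, a i ≤ b i → (f.eval a * f.eval b) i ≤ 0 →
      a i ≤ c ∧ c ≤ b i ∧ (f.map (Pi.evalRingHom (fun _ => F) i)).eval c = 0 := by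
    intro i
    by_cases hi : a i ≤ b i ∧ (f.eval a * f.eval b) i ≤ 0
    · obtain ⟨c, hc⟩ := hF (f.map (Pi.evalRingHom (fun _ => F) i)) (a i) (b i) hi.1 (by
        rw [eval_map_evalRingHom, eval_map_evalRingHom]
        exact hi.2)
      exact ⟨c, fun _ _ => hc⟩
    · exact ⟨0, fun h1 h2 => absurd ⟨h1, h2⟩ hi⟩
  choose c hc using key
  refine ⟨(c : Filter.Germ (U : Filter ι) F), ?_, ?_, ?_⟩
  · rw [Filter.Germ.coe_le]
    filter_upwards [hab, h] with i h1 h2 using (hc i h1 h2).1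
  · rw [Filter.Germ.coe_le]
    filter_upwards [hab, h] with i h1 h2 using (hc i h1 h2).2.1
  · rw [he, ← Filter.Germ.coe_zero, Filter.Germ.coe_eq]
    filter_upwards [hab, h] with i h1 h2
    rw [← eval_map_evalRingHom]
    exact (hc i h1 h2).2.2

theorem Filter.Germ.sign_coe_eq_iff {ι F : Type*} [Field F] [LinearOrder F] [IsStrictOrderedRing F]
    {U : Ultrafilter ι} {f : ι → F} {σ : SignType} :
    SignType.sign (f : Filter.Germ (U : Filter ι) F) = σ ↔
      ∀ᶠ i in (U : Filter ι), SignType.sign (f i) = σ := by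
  cases σ
  · simp only [SignType.zero_eq_zero, sign_eq_zero_iff, ← Filter.Germ.coe_zero,
      Filter.Germ.coe_eq]
    rfl
  · simp only [SignType.neg_eq_neg_one, sign_eq_neg_one_iff, ← Filter.Germ.coe_zero,
      Filter.Germ.coe_lt]
    rfl
  · simp only [SignType.pos_eq_one, sign_eq_one_iff, Filter.Germ.coe_pos]

variable {E : Type*} [Field E] [LinearOrder E]

/-- A homomorphism to an ordered field is approximable if on each finite set its signs are those of
a real-valued homomorphism. -/
def SignApproximable {A : Type*} [CommRing A] (φ : A →+* E) : Prop :=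
  ∀ s : Finset A, ∃ χ : A →+* ℝ, ∀ a ∈ s, SignType.sign (χ a) = SignType.sign (φ a)

theorem SignApproximable.comp_symm {A B : Type*} [CommRing A] [CommRing B] (e : A ≃+* B)
    {φ : A →+* E} (h : SignApproximable (φ.comp (e.symm : B →+* A))) : SignApproximable φ := by
  classical
  intro s
  obtain ⟨χ, hχ⟩ := h (s.image e)
  exact ⟨χ.comp (e : A →+* B), fun a ha => by simpa using hχ (e a) (Finset.mem_image_of_mem e ha)⟩

variable [IsStrictOrderedRing E]

theorem SignApproximable.polynomial (hE : PolynomialIVT E) {A : Type*} [CommRing A]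
    {φ : A[X] →+* E} (h : SignApproximable (φ.comp C)) : SignApproximable φ := by
  classical
  intro T
  choose χ hχ using h
  let U : Ultrafilter (Finset A) := Ultrafilter.of Filter.atTop
  let ψ : A →+* Filter.Germ (U : Filter (Finset A)) ℝ :=
    (Filter.Germ.coeRingHom (U : Filter (Finset A))).comp (RingHom.pi χ)
  have hψ : ∀ a, SignType.sign (φ.comp C a) = SignType.sign (ψ a) := fun a => by
    refine (Filter.Germ.sign_coe_eq_iff.2 ?_).symm
    refine Ultrafilter.of_le _ ?_
    filter_upwards [Filter.eventually_ge_atTop {a}] with s hs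
    exact hχ s a (hs (Finset.mem_singleton_self a))
  obtain ⟨c', hc'⟩ := exists_sign_eval_eq hE (Real.polynomialIVT.germ U) (φ.comp C) ψ hψ (φ X) T
  induction c' using Filter.Germ.inductionOn with
  | _ γ =>
  have hev : ∀ p ∈ T, ∀ᶠ s in (U : Filter (Finset A)),
      SignType.sign (eval₂RingHom (χ s) (γ s) p) = SignType.sign (φ p) := by
    intro p hp
    rw [← Filter.Germ.sign_coe_eq_iff (U := U) (f := fun s => eval₂RingHom (χ s) (γ s) p)]
    have h1 : (p.map (φ.comp C)).eval (φ X) = φ p := by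
      rw [eval_map, ← hom_eval₂, eval₂_C_X]
    have h2 : (p.map ψ).eval (γ : Filter.Germ (U : Filter (Finset A)) ℝ) =
        ((fun s => eval₂RingHom (χ s) (γ s) p : Finset A → ℝ) :
          Filter.Germ (U : Filter (Finset A)) ℝ) := by
      have h3 : (p.map (RingHom.pi χ)).eval γ = fun s => eval₂RingHom (χ s) (γ s) p := by
        funext s
        rw [← eval_map_evalRingHom, Polynomial.map_map, eval_map]
        rfl
      rw [← Polynomial.map_map, ← h3]
      exact eval_map_apply (f := Filter.Germ.coeRingHom (U : Filter (Finset A)))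
        (p := p.map (RingHom.pi χ)) γ
    rw [← h2, ← hc' p hp, h1]
  obtain ⟨s, hs⟩ := ((Filter.eventually_all_finset T).2 hev).exists
  exact ⟨eval₂RingHom (χ s) (γ s), hs⟩

theorem sign_map_real (φ : ℝ →+* E) (r : ℝ) : SignType.sign (φ r) = SignType.sign r := by
  have hpos : ∀ r : ℝ, 0 < r → 0 < φ r := fun r hr => by
    rw [← Real.mul_self_sqrt hr.le, map_mul]
    exact mul_self_pos.2 ((map_ne_zero φ).2 (Real.sqrt_pos.2 hr).ne')
  rcases lt_trichotomy r 0 with h | rfl | h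
  · rw [sign_neg h, sign_neg (by simpa using hpos (-r) (by simpa using h))]
  · simp
  · rw [sign_pos h, sign_pos (hpos r h)]

theorem signApproximable_mvPolynomial (hE : PolynomialIVT E) (n : ℕ)
    (φ : MvPolynomial (Fin n) ℝ →+* E) : SignApproximable φ := by
  induction n with
  | zero =>
    refine fun s => ⟨MvPolynomial.eval 0, fun a _ => ?_⟩
    obtain ⟨r, rfl⟩ := MvPolynomial.C_surjective (Fin 0) a
    rw [MvPolynomial.eval_C]
    exact (sign_map_real (φ.comp MvPolynomial.C) r).symm
  | succ n ih =>
    exact .comp_symm (MvPolynomial.finSuccEquiv ℝ n).toRingEquiv (.polynomial hE (ih _))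

/-- A homomorphism from a real polynomial ring to an ordered field can be replaced by evaluation at
a real point, as far as the vanishing of finitely many polynomials is concerned. -/
theorem exists_eval_eq_zero_iff (hE : PolynomialIVT E) {n : ℕ} (φ : MvPolynomial (Fin n) ℝ →+* E)
    (s : Finset (MvPolynomial (Fin n) ℝ)) :
    ∃ x : Fin n → ℝ, ∀ p ∈ s, MvPolynomial.eval x p = 0 ↔ φ p = 0 := by
  obtain ⟨χ, hχ⟩ := signApproximable_mvPolynomial hE n φ s
  refine ⟨fun i => χ (MvPolynomial.X i), fun p hp => ?_⟩
  have : MvPolynomial.eval (fun i => χ (MvPolynomial.X i)) = χ :=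
    MvPolynomial.ringHom_ext (fun r => by
      rw [MvPolynomial.eval_C]
      exact congrArg (fun f : ℝ →+* ℝ => f r)
        (Subsingleton.elim (RingHom.id ℝ) (χ.comp MvPolynomial.C))) fun i => by simp
  rw [this, ← sign_eq_zero_iff, hχ p hp, sign_eq_zero_iff]

end Transfer

section RealNullstellensatz

/-- An ideal is real if it contains the summands of each sum of squares that it contains. -/
def Ideal.IsReal {A : Type*} [CommRing A] (I : Ideal A) : Prop :=
  ∀ a s, IsSumSq s → a * a + s ∈ I → a ∈ I

namespace Ideal.IsReal

variable {A : Type*} [CommRing A] {I : Ideal A}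

theorem colon (hI : I.IsReal) (b : A) : IsReal (I.colon {b}) := by
  intro a s hs h
  rw [Submodule.mem_colon_singleton, smul_eq_mul] at h ⊢
  refine hI (a * b) (s * (b * b)) (hs.mul (.mul_self b)) ?_
  have : a * b * (a * b) + s * (b * b) = b * ((a * a + s) * b) := by ring
  rw [this]
  exact I.mul_mem_left b h

theorem mem_of_mul_self_mem (hI : I.IsReal) {a : A} (h : a * a ∈ I) : a ∈ I :=
  hI a 0 .zero (by simpa using h)

theorem exists_prime (hI : I.IsReal) {q : A} (hq : q ∉ I) :
    ∃ J : Ideal A, I ≤ J ∧ J.IsReal ∧ q ∉ J ∧ J.IsPrime := by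
  obtain ⟨J, hIJ, hJ⟩ := zorn_le_nonempty₀ {J : Ideal A | J.IsReal ∧ q ∉ J} (by
    intro c hc hchain y hy
    have hmem : ∀ {x}, x ∈ sSup c ↔ ∃ J ∈ c, x ∈ J := fun {x} =>
      Submodule.mem_sSup_of_directed ⟨y, hy⟩ hchain.directedOn
    refine ⟨sSup c, ⟨fun a s hs h => ?_, fun h => ?_⟩, fun J hJ => le_sSup hJ⟩
    · obtain ⟨J, hJ, h⟩ := hmem.1 h
      exact hmem.2 ⟨J, hJ, (hc hJ).1 a s hs h⟩
    · obtain ⟨J, hJ, h⟩ := hmem.1 h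
      exact (hc hJ).2 h) I ⟨hI, hq⟩
  obtain ⟨hJr, hqJ⟩ := hJ.prop
  have hcolon : ∀ a b, a * b ∈ J → b ∉ J → q * a ∈ J := by
    intro a b hab hb
    by_contra hq
    refine hb (hJ.le_of_ge (y := J.colon {a}) ⟨hJr.colon a, ?_⟩ ?_ ?_)
    · rwa [Submodule.mem_colon_singleton]
    · exact fun x hx => Submodule.mem_colon_singleton.2 (J.mul_mem_right a hx)
    · rw [Submodule.mem_colon_singleton, smul_eq_mul, mul_comm]
      exact hab
  refine ⟨J, hIJ, hJr, hqJ, fun h => hqJ (h ▸ Submodule.mem_top), fun {a b} hab => ?_⟩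
  by_contra! hcon
  exact hqJ (hJr.mem_of_mul_self_mem (hcolon q a (hcolon a b hab hcon.2) hcon.1))

theorem not_isSumSq_neg_one_fractionRing (hI : I.IsReal) [hp : I.IsPrime] :
    ¬ IsSumSq (-1 : FractionRing (A ⧸ I)) := by
  let π : A →+* FractionRing (A ⧸ I) := (algebraMap (A ⧸ I) _).comp (Ideal.Quotient.mk I)
  have hπ : ∀ a, π a = 0 ↔ a ∈ I := fun a => by
    simp [π, Ideal.Quotient.eq_zero_iff_mem]
  have hlift : ∀ x : FractionRing (A ⧸ I), IsSumSq x → ∃ d s : A, d ∉ I ∧ IsSumSq s ∧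
      x * (π d * π d) = π s := by
    intro x hx
    induction hx with
    | zero => exact ⟨1, 0, (Ideal.ne_top_iff_one I).1 hp.ne_top, .zero, by simp⟩
    | sq_add a hs ih =>
      obtain ⟨d, t, hd, ht, h⟩ := ih
      obtain ⟨u, v, hv, rfl⟩ := IsFractionRing.div_surjective (A := A ⧸ I) a
      obtain ⟨u, rfl⟩ := Ideal.Quotient.mk_surjective u
      obtain ⟨v, rfl⟩ := Ideal.Quotient.mk_surjective v
      have hv' : v ∉ I := fun h => nonZeroDivisors.ne_zero hv (Ideal.Quotient.eq_zero_iff_mem.2 h)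
      refine ⟨v * d, u * d * (u * d) + v * v * t, fun h => (hp.mem_or_mem h).elim hv' hd,
        .add (.mul_self _) (.mul (.mul_self v) ht), ?_⟩
      change (π u / π v * (π u / π v) + _) * _ = _
      have hv0 : π v ≠ 0 := fun h => hv' ((hπ v).1 h)
      simp only [map_add, map_mul, ← h]
      field_simp
  intro h
  obtain ⟨d, s, hd, hs, h⟩ := hlift _ h
  refine hd (hI d s hs ((hπ _).1 ?_))
  rw [map_add, map_mul, ← h]
  ring

/-- The real Nullstellensatz: a real ideal that contains `p` contains every polynomial vanishing on
the real zero set of `p`. -/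
theorem mem_of_forall_eval_eq_zero {n : ℕ} {I : Ideal (MvPolynomial (Fin n) ℝ)} (hI : I.IsReal)
    {p q : MvPolynomial (Fin n) ℝ} (hp : p ∈ I)
    (h : ∀ x, MvPolynomial.eval x p = 0 → MvPolynomial.eval x q = 0) : q ∈ I := by
  classical
  by_contra hq
  obtain ⟨J, hIJ, hJ, hqJ, _⟩ := hI.exists_prime hq
  obtain ⟨E, _, _, _, hE, ⟨φ⟩⟩ :=
    exists_ringHom_polynomialIVT hJ.not_isSumSq_neg_one_fractionRing
  obtain ⟨x, hx⟩ := exists_eval_eq_zero_iff hE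
    (φ.comp ((algebraMap (_ ⧸ J) (FractionRing (_ ⧸ J))).comp (Ideal.Quotient.mk J))) {p, q}
  simp only [RingHom.comp_apply, map_eq_zero, FaithfulSMul.algebraMap_eq_zero_iff,
    Ideal.Quotient.eq_zero_iff_mem, Finset.mem_insert, Finset.mem_singleton, forall_eq_or_imp,
    forall_eq] at hx
  exact hqJ (hx.2.1 (h x (hx.1.2 (hIJ hp))))

end Ideal.IsReal

end RealNullstellensatz

section PositiveFunctional

variable {n : ℕ}

theorem starC_add (P Q : MvPolynomial (Fin n) ℂ) : starC (P + Q) = starC P + starC Q :=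
  map_add _ P Q

theorem starC_mul (P Q : MvPolynomial (Fin n) ℂ) : starC (P * Q) = starC P * starC Q :=
  map_mul _ P Q

theorem starC_C (z : ℂ) : starC (MvPolynomial.C z : MvPolynomial (Fin n) ℂ) =
    MvPolynomial.C (starRingEnd ℂ z) :=
  MvPolynomial.map_C _ z

theorem starC_map_ofReal (p : MvPolynomial (Fin n) ℝ) :
    starC (p.map Complex.ofRealHom) = p.map Complex.ofRealHom := by
  rw [starC, MvPolynomial.map_map]
  exact congrArg (fun f => MvPolynomial.map f p) (RingHom.ext fun r => Complex.conj_ofReal r)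

theorem evalC_map_ofReal (p : MvPolynomial (Fin n) ℝ) (x : Fin n → ℝ) :
    evalC (p.map Complex.ofRealHom) x = (MvPolynomial.eval x p : ℝ) := by
  rw [evalC, MvPolynomial.aeval_def, MvPolynomial.eval₂_map]
  exact (MvPolynomial.eval₂_comp_left Complex.ofRealHom (RingHom.id ℝ) x p).symm

theorem exists_eq_map_ofReal_add (P : MvPolynomial (Fin n) ℂ) :
    ∃ A B : MvPolynomial (Fin n) ℝ,
      P = A.map Complex.ofRealHom + MvPolynomial.C Complex.I * B.map Complex.ofRealHom := by
  induction P using MvPolynomial.induction_on with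
  | C z =>
    refine ⟨.C z.re, .C z.im, ?_⟩
    simp only [MvPolynomial.map_C, ← map_mul, ← map_add, Complex.ofRealHom_eq_coe]
    rw [mul_comm, Complex.re_add_im]
  | add P Q hP hQ =>
    obtain ⟨A, B, rfl⟩ := hP
    obtain ⟨A', B', rfl⟩ := hQ
    refine ⟨A + A', B + B', ?_⟩
    simp only [map_add]
    ring
  | mul_X P i hP =>
    obtain ⟨A, B, rfl⟩ := hP
    refine ⟨A * .X i, B * .X i, ?_⟩
    simp only [map_mul, MvPolynomial.map_X]
    ring

theorem starC_mul_self_eq (A B : MvPolynomial (Fin n) ℝ) :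
    starC (A.map Complex.ofRealHom + MvPolynomial.C Complex.I * B.map Complex.ofRealHom) *
      (A.map Complex.ofRealHom + MvPolynomial.C Complex.I * B.map Complex.ofRealHom) =
      (A * A + B * B).map Complex.ofRealHom := by
  have hI : (MvPolynomial.C Complex.I : MvPolynomial (Fin n) ℂ) * .C Complex.I = -1 := by
    rw [← map_mul, Complex.I_mul_I, map_neg, map_one]
  simp only [starC_add, starC_mul, starC_C, starC_map_ofReal, Complex.conj_I, map_neg, map_add,
    map_mul]
  linear_combination
    (-(B.map Complex.ofRealHom * B.map Complex.ofRealHom : MvPolynomial (Fin n) ℂ)) * hI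

theorem eval_mul_self_add_eq_zero_iff (A B : MvPolynomial (Fin n) ℝ) (x : Fin n → ℝ) :
    MvPolynomial.eval x (A * A + B * B) = 0 ↔
      x ∈ zSetC (A.map Complex.ofRealHom + MvPolynomial.C Complex.I * B.map Complex.ofRealHom) := by
  have h : evalC (A.map Complex.ofRealHom + MvPolynomial.C Complex.I * B.map Complex.ofRealHom) x =
      ⟨MvPolynomial.eval x A, MvPolynomial.eval x B⟩ := by
    have hC : evalC (MvPolynomial.C Complex.I : MvPolynomial (Fin n) ℂ) x = Complex.I :=
      MvPolynomial.aeval_C _ _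
    rw [Complex.mk_eq_add_mul_I, ← evalC_map_ofReal, ← evalC_map_ofReal, mul_comm _ Complex.I]
    nth_rewrite 2 [← hC]
    simp only [evalC, map_add, map_mul]
  change _ ↔ evalC _ x = 0
  rw [h, Complex.ext_iff, map_add, map_mul, map_mul]
  exact mul_self_add_mul_self_eq_zero

theorem eq_zero_of_forall_nonneg {α β c : ℂ}
    (h : ∀ z : ℂ, 0 ≤ starRingEnd ℂ z * α + z * β + starRingEnd ℂ z * z * c) (hc : 0 ≤ c) :
    α = 0 := by
  rw [Complex.nonneg_iff] at hc
  have hre : β.re = α.re := by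
    have := (Complex.nonneg_iff.1 (h Complex.I)).2
    simp [← hc.2] at this
    linarith
  have him : β.im = -α.im := by
    have := (Complex.nonneg_iff.1 (h 1)).2
    simp [← hc.2] at this
    linarith
  have key : ∀ t : ℝ, 0 ≤ (-2 * t + t ^ 2 * c.re) * (α.re * α.re + α.im * α.im) := fun t => by
    have := (Complex.nonneg_iff.1 (h (-(t : ℂ) * α))).1
    simp [hre, him, ← hc.2] at this
    linarith
  have ht := key (1 / (c.re + 1))
  have hpos : 0 < c.re + 1 := by linarith [hc.1]
  have hneg : -2 * (1 / (c.re + 1)) + (1 / (c.re + 1)) ^ 2 * c.re < 0 := by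
    have : -2 * (1 / (c.re + 1)) + (1 / (c.re + 1)) ^ 2 * c.re =
        -((c.re + 2) / (c.re + 1) ^ 2) := by
      field_simp
      ring
    rw [this, neg_lt_zero]
    exact div_pos (by linarith) (by positivity)
  have h0 := nonpos_of_mul_nonneg_right ht hneg
  have h1 := mul_self_add_mul_self_eq_zero.1
    (h0.antisymm (add_nonneg (mul_self_nonneg _) (mul_self_nonneg _)))
  exact Complex.ext h1.1 h1.2

variable {Λ : MvPolynomial (Fin n) ℂ →ₗ[ℂ] ℂ}

theorem IsPosDefC.eq_zero_of_starC_mul_self (hΛ : IsPosDefC Λ) {r : MvPolynomial (Fin n) ℂ}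
    (h : Λ (starC r * r) = 0) : Λ r = 0 := by
  have hsmul : ∀ (z : ℂ) p, Λ (MvPolynomial.C z * p) = z * Λ p := fun z p => by
    rw [← MvPolynomial.smul_eq_C_mul, map_smul, smul_eq_mul]
  refine eq_zero_of_forall_nonneg (β := Λ (starC r)) (c := Λ 1) (fun z => ?_) ?_
  · have hz : starC (r + MvPolynomial.C z) * (r + MvPolynomial.C z) =
        starC r * r + MvPolynomial.C (starRingEnd ℂ z) * r + MvPolynomial.C z * starC r +
          MvPolynomial.C (starRingEnd ℂ z * z) * 1 := by
      rw [starC_add, starC_C, map_mul]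
      ring
    have := hΛ (r + MvPolynomial.C z)
    rwa [hz, map_add, map_add, map_add, h, hsmul, hsmul, hsmul, zero_add] at this
  · simpa [starC] using hΛ 1

/-- The real polynomials that annihilate a linear functional. -/
noncomputable def realAnnihilator (Λ : MvPolynomial (Fin n) ℂ →ₗ[ℂ] ℂ) :
    Ideal (MvPolynomial (Fin n) ℝ) where
  carrier := {p | ∀ w, Λ (p.map Complex.ofRealHom * w) = 0}
  zero_mem' := fun w => by simp
  add_mem' := fun {p q} hp hq w => by rw [map_add, add_mul, map_add, hp w, hq w, add_zero]
  smul_mem' := fun c p hp w => by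
    rw [smul_eq_mul, mul_comm c, map_mul (MvPolynomial.map _), mul_assoc]
    exact hp _

theorem IsPosDefC.isReal_realAnnihilator (hΛ : IsPosDefC Λ) : (realAnnihilator Λ).IsReal := by
  have hsq : ∀ (a : MvPolynomial (Fin n) ℝ) w,
      0 ≤ Λ ((a * a).map Complex.ofRealHom * (starC w * w)) := fun a w => by
    have := hΛ (a.map Complex.ofRealHom * w)
    rw [starC_mul, starC_map_ofReal, mul_mul_mul_comm] at this
    rwa [map_mul (MvPolynomial.map _)]
  intro a s hs h w
  have hsum : 0 ≤ Λ (s.map Complex.ofRealHom * (starC w * w)) := by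
    clear h
    induction hs with
    | zero => simp
    | sq_add b _ ih =>
      rw [map_add, add_mul, map_add]
      exact add_nonneg (hsq b w) ih
  have h0 := h (starC w * w)
  rw [map_add, add_mul, map_add, add_eq_zero_iff_of_nonneg (hsq a w) hsum] at h0
  refine hΛ.eq_zero_of_starC_mul_self ?_
  rw [starC_mul, starC_map_ofReal, mul_mul_mul_comm, ← map_mul]
  exact h0.1

theorem IsPosDefC.vanishesOnC_of_zSetC_subset (hΛ : IsPosDefC Λ) {P Q : MvPolynomial (Fin n) ℂ}
    (hPQ : zSetC P ⊆ zSetC Q) (hP : VanishesOnC Λ (Ideal.span {P})) :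
    VanishesOnC Λ (Ideal.span {Q}) := by
  obtain ⟨A, B, rfl⟩ := exists_eq_map_ofReal_add P
  obtain ⟨A', B', rfl⟩ := exists_eq_map_ofReal_add Q
  have hreal := hΛ.isReal_realAnnihilator
  have hp : A * A + B * B ∈ realAnnihilator Λ := fun w => by
    rw [← starC_mul_self_eq]
    refine hP _ (Ideal.mul_mem_right _ _ (Ideal.mul_mem_left _ _ ?_))
    exact Ideal.mem_span_singleton_self _
  have hq : A' * A' + B' * B' ∈ realAnnihilator Λ :=
    hreal.mem_of_forall_eval_eq_zero hp fun x hx =>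
      (eval_mul_self_add_eq_zero_iff A' B' x).2 (hPQ ((eval_mul_self_add_eq_zero_iff A B x).1 hx))
  have hA' : A' ∈ realAnnihilator Λ := hreal A' (B' * B') (.mul_self B') hq
  have hB' : B' ∈ realAnnihilator Λ := hreal B' (A' * A') (.mul_self A') (by rwa [add_comm])
  intro R hR
  obtain ⟨w, rfl⟩ := Ideal.mem_span_singleton.1 hR
  rw [add_mul, map_add, hA' w, mul_comm (MvPolynomial.C Complex.I), mul_assoc, hB', add_zero]

end PositiveFunctional

theorem stmt_3 (n : ℕ) (hn : 0 < n) (P Q : MvPolynomial (Fin n) ℂ)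
    (hPQ : zSetC P = zSetC Q) :
    IsTypeAC P ↔ IsTypeAC Q :=
  ⟨fun h Λ hΛ hQ => h Λ hΛ (hΛ.vanishesOnC_of_zSetC_subset hPQ.ge hQ),
    fun h Λ hΛ hP => h Λ hΛ (hΛ.vanishesOnC_of_zSetC_subset hPQ.le hP)⟩
end
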